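/- arXiv:1607.07164 — 2 statements merged into one kernel-verified Lean document; each statement's English description precedes it below -/
import Mathlib

section
/- For every integer b ≥ 2 and every positive integer k, the set of real numbers that are normal of order k in base b but not normal of order k+1 in base b has full Hausdorff dimension; that is, dim_H(N_k(b) \ N_{k+1}(b)) = 1. -/
open Filter MeasureTheory Finset
open scoped Topology Classical

/-- A basic sequence: a sequence of integers, each at least `2`. -/
def IsBasic (q : ℕ → ℕ) : Prop := ∀ n, 2 ≤ q n

/-- The product `q_0 q_1 ⋯ q_{n-1}` of the first `n` terms of the basic sequence. -/
def qprod (q : ℕ → ℕ) (n : ℕ) : ℝ := ∏ i ∈ Finset.range n, (q i : ℝ)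

/-- `T_{Q,n}(x) = (q_0 q_1 ⋯ q_{n-1}) x mod 1`. -/
noncomputable def TQ (q : ℕ → ℕ) (n : ℕ) (x : ℝ) : ℝ := Int.fract (qprod q n * x)

/-- The `n`-th digit `E_n` of the `Q`-Cantor series expansion of `x`
(digit positions are indexed by `0, 1, 2, …`). -/
noncomputable def qdigit (q : ℕ → ℕ) (x : ℝ) (n : ℕ) : ℕ := ⌊(q n : ℝ) * TQ q n x⌋₊

/-- `N_n^Q(B,x)`: the number of occurrences of the block `B` starting among the first `n`
digit positions of the `Q`-Cantor series expansion of `x`. -/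
noncomputable def blockCount (q : ℕ → ℕ) (x : ℝ) {k : ℕ} (B : Fin k → ℕ) (n : ℕ) : ℕ :=
  ((Finset.range n).filter fun i => ∀ j : Fin k, qdigit q x (i + (j : ℕ)) = B j).card

/-- `Q_n^{(k)} = ∑_{j<n} 1/(q_j q_{j+1} ⋯ q_{j+k-1})`. -/
noncomputable def Qsum (q : ℕ → ℕ) (k n : ℕ) : ℝ :=
  ∑ j ∈ Finset.range n, (∏ i ∈ Finset.range k, (q (j + i) : ℝ))⁻¹

/-- `x` is `Q`-normal of order `k`: every block of length `k` occurs with the expected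
asymptotic frequency. -/
def QNormalOfOrder (q : ℕ → ℕ) (k : ℕ) (x : ℝ) : Prop :=
  ∀ B : Fin k → ℕ,
    Tendsto (fun n => (blockCount q x B n : ℝ) / Qsum q k n) atTop (𝓝 1)

/-- `x ∈ N(Q)`: `x` is `Q`-normal of every order `k ≥ 1`. -/
def QNormal (q : ℕ → ℕ) (x : ℝ) : Prop := ∀ k, 1 ≤ k → QNormalOfOrder q k x

/-- `Q` is fully divergent: `Q_n^{(k)} → ∞` for every `k ≥ 1`. -/
def FullyDivergent (q : ℕ → ℕ) : Prop :=
  ∀ k, 1 ≤ k → Tendsto (fun n => Qsum q k n) atTop atTop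

/-- `Q` is infinite in limit: `q_n → ∞`. -/
def InfiniteInLimit (q : ℕ → ℕ) : Prop := Tendsto q atTop atTop

/-- `N_{n,m,r}^Q(B,x)`: occurrences of the block `B` (of length `m`) starting at
positions `i < n` with `i ≡ r (mod m)`. -/
noncomputable def apCount (q : ℕ → ℕ) (x : ℝ) (m r : ℕ) (B : Fin m → ℕ) (n : ℕ) : ℕ :=
  ((Finset.range n).filter fun i =>
    i % m = r ∧ ∀ j : Fin m, qdigit q x (i + (j : ℕ)) = B j).card

/-- `Q_n^{(m,r)} = ∑_{j=0}^{⌊(n-r)/m⌋} 1/(q_{mj+r} q_{mj+r+1} ⋯ q_{mj+r+m-1})`. -/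
noncomputable def apQsum (q : ℕ → ℕ) (m r n : ℕ) : ℝ :=
  ∑ j ∈ Finset.range ((n - r) / m + 1),
    (∏ i ∈ Finset.range m, (q (m * j + r + i) : ℝ))⁻¹

/-- `x ∈ N^{I}_{m,r}(Q)`. -/
def MemNAPI (q : ℕ → ℕ) (m r : ℕ) (x : ℝ) : Prop :=
  ∀ B : Fin m → ℕ,
    Tendsto (fun n => (apCount q x m r B n : ℝ) / apQsum q m r n) atTop (𝓝 1)

/-- `x ∈ N^{I}_{Ab}(Q)`: `x` is AP `Q`-abnormal of type I. -/
def APAbnormalI (q : ℕ → ℕ) (x : ℝ) : Prop :=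
  ∀ m, 2 ≤ m → ∀ r, r < m → ¬ MemNAPI q m r x

/-- `x ∈ RN^{I}(Q)`. -/
def MemRNI (q : ℕ → ℕ) (x : ℝ) : Prop :=
  ∀ m, 1 ≤ m → ∀ r, r < m → ∀ B₁ B₂ : Fin m → ℕ,
    Tendsto (fun n => (apCount q x m r B₁ n : ℝ) / (apCount q x m r B₂ n : ℝ))
      atTop (𝓝 1)

/-- `Λ_{m,r}(Q) = (q_{mt+r})_t`. -/
def lamQ (q : ℕ → ℕ) (m r : ℕ) : ℕ → ℕ := fun t => q (m * t + r)

/-- `Υ_{Q,m,r}(x)`: the real number whose `Λ_{m,r}(Q)`-Cantor series digits are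
`(E_{mt+r})_t`, where `(E_n)` are the `Q`-Cantor series digits of `x`. -/
noncomputable def Ups (q : ℕ → ℕ) (m r : ℕ) (x : ℝ) : ℝ :=
  ∑' t : ℕ, (qdigit q x (m * t + r) : ℝ) / ∏ i ∈ Finset.range (t + 1), (lamQ q m r i : ℝ)

/-- `x ∈ N^{II}_{k,m,r}(Q) = Υ_{Q,m,r}^{-1}(N_k(Λ_{m,r}(Q)))`. -/
def MemNAPII (q : ℕ → ℕ) (k m r : ℕ) (x : ℝ) : Prop :=
  QNormalOfOrder (lamQ q m r) k (Ups q m r x)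

/-- `x ∈ N^{II}(Q)`: `x` is AP `Q`-normal of type II. -/
def APNormalII (q : ℕ → ℕ) (x : ℝ) : Prop :=
  ∀ k, 1 ≤ k → ∀ m, 1 ≤ m → ∀ r, r < m → MemNAPII q k m r x

/-- `x ∈ RN^{II}(Q)`: for all `k, m, r` the counts in `Υ_{Q,m,r}(x)` of any two blocks of
length `k` with respect to `Λ_{m,r}(Q)` have ratio tending to `1`. -/
def MemRNII (q : ℕ → ℕ) (x : ℝ) : Prop :=
  ∀ k, 1 ≤ k → ∀ m, 1 ≤ m → ∀ r, r < m → ∀ B₁ B₂ : Fin k → ℕ,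
    Tendsto (fun n =>
      (blockCount (lamQ q m r) (Ups q m r x) B₁ n : ℝ) /
      (blockCount (lamQ q m r) (Ups q m r x) B₂ n : ℝ)) atTop (𝓝 1)

/-- `S` (a set of positive integers) is almost closed under addition: for every `k ∈ S`,
the set `{x ∉ S : x + k ∈ S}` has asymptotic density `0`. -/
def AlmostClosed (S : Set ℕ) : Prop :=
  ∀ k ∈ S, Tendsto
    (fun t : ℕ => (((Finset.Icc 1 t).filter fun x => x ∉ S ∧ x + k ∈ S).card : ℝ) / t)
    atTop (𝓝 0)

/-- The sequence `u` of reals is uniformly distributed mod 1. -/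
def UDMod1 (u : ℕ → ℝ) : Prop :=
  ∀ a b : ℝ, 0 ≤ a → a < b → b ≤ 1 →
    Tendsto (fun N => (((Finset.range N).filter fun n => u n ∈ Set.Ico a b).card : ℝ) / N)
      atTop (𝓝 (b - a))

/-- `x ∈ DN(Q)`: `x` is `Q`-distribution normal. -/
def DistNormal (q : ℕ → ℕ) (x : ℝ) : Prop := UDMod1 fun n => TQ q n x

/-- `x ∈ DN_{Ab}(Q)`: `x` is AP `Q`-distribution abnormal. -/
def APDistAbnormal (q : ℕ → ℕ) (x : ℝ) : Prop :=
  ∀ m, 2 ≤ m → ∀ r, r < m → ¬ UDMod1 fun n => TQ q (m * n + r) x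

/-- `y ∈ D_{(x_n)}(Q)`: for every `ξ ∈ (0,1)`, the proportion of `n ≤ N` with
`fract (T_{Q,n}(y) - x_n) < ξ` tends to `1`. -/
def MemD (q : ℕ → ℕ) (xs : ℕ → ℝ) (y : ℝ) : Prop :=
  ∀ ξ : ℝ, 0 < ξ → ξ < 1 →
    Tendsto (fun N =>
      (((Finset.range N).filter fun n => Int.fract (TQ q n y - xs n) < ξ).card : ℝ) / N)
      atTop (𝓝 1)

/-- A computable real number. -/
def ComputableReal (x : ℝ) : Prop :=
  ∃ f : ℕ → ℕ, Computable f ∧ ∀ n : ℕ, 0 < n → (f n : ℝ) / n ≤ x ∧ x ≤ ((f n : ℝ) + 1) / n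

/-- The indicator function `1_{ℕ∖S}` of the complement of `S`, with values in `ℤ`. -/
noncomputable def indZ (S : Set ℕ) (i : ℕ) : ℤ := if i ∈ S then 0 else 1

/-- The indicator function `1_{ℕ∖S}` of the complement of `S`, with values in `ℝ`. -/
noncomputable def indR (S : Set ℕ) (i : ℕ) : ℝ := if i ∈ S then 0 else 1

/-- The coefficients `c_{t,i}`: `c_{t,1} = t (1+ε)^{1_{ℕ∖S}(1)}` and
`c_{t,i} = (1+ε)^{1_{ℕ∖S}(i) - 1_{ℕ∖S}(i-1)}` for `i ≥ 2`. -/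
noncomputable def coeff (S : Set ℕ) (ε : ℝ) (t i : ℕ) : ℝ :=
  if i = 1 then (t : ℝ) * (1 + ε) ^ indZ S 1
  else (1 + ε) ^ (indZ S i - indZ S (i - 1))

/-- `N_k(b)`: the set of real numbers normal of order `k` in base `b`. -/
def BaseNormalOfOrder (b k : ℕ) : Set ℝ :=
  {x | ∀ B : Fin k → ℕ, (∀ j, B j < b) →
    Tendsto (fun n => (blockCount (fun _ => b) x B n : ℝ) / n) atTop
      (𝓝 (((b : ℝ) ^ k)⁻¹))}

theorem ae_tendsto_frequency {Ω : Type*} [MeasurableSpace Ω] {μ : Measure Ω}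
    [IsProbabilityMeasure μ] {A : ℕ → Set Ω} {p : ℝ} (hA : ∀ t, MeasurableSet (A t))
    (hp : ∀ t, μ.real (A t) = p) (hpp : ∀ s t, s ≠ t → μ.real (A s ∩ A t) = p * p) :
    ∀ᵐ ω ∂μ, Tendsto
      (fun n : ℕ => (∑ t ∈ Finset.range n, (A t).indicator (fun _ => (1 : ℝ)) ω) / n)
      atTop (𝓝 p) := by
  have hμ : ∀ s t, μ (A s) = μ (A t) := fun s t => by
    rw [← ENNReal.toReal_eq_toReal_iff' (measure_ne_top _ _) (measure_ne_top _ _)]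
    exact (hp s).trans (hp t).symm
  have hmeas : ∀ t, Measurable ((A t).indicator fun _ => (1 : ℝ)) := fun t =>
    measurable_const.indicator (hA t)
  have key := ProbabilityTheory.strong_law_ae_real (μ := μ)
    (fun t => (A t).indicator fun _ => (1 : ℝ)) ?_ ?_ ?_
  · have hint : ∫ ω, (A 0).indicator (fun _ => (1 : ℝ)) ω ∂μ = p := by
      rw [integral_indicator_const _ (hA 0), hp 0]; simp
    rw [hint] at key
    exact key
  · exact (integrable_const 1).indicator (hA 0)
  · intro s t hst
    have h : ProbabilityTheory.IndepSet (A s) (A t) μ := by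
      rw [ProbabilityTheory.indepSet_iff_measure_inter_eq_mul (hA s) (hA t) μ,
        ← ENNReal.toReal_eq_toReal_iff' (measure_ne_top _ _)
          (ENNReal.mul_ne_top (measure_ne_top _ _) (measure_ne_top _ _)), ENNReal.toReal_mul]
      change μ.real _ = μ.real _ * μ.real _
      rw [hpp s t hst, hp, hp]
    have hle : ∀ t, MeasurableSpace.comap ((A t).indicator fun _ => (1 : ℝ)) inferInstance ≤
        MeasurableSpace.generateFrom {A t} := fun t =>
      Measurable.comap_le (m₁ := MeasurableSpace.generateFrom {A t}) <|
        Measurable.indicator (m := _) (by exact measurable_const)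
          (MeasurableSpace.measurableSet_generateFrom rfl)
    rw [ProbabilityTheory.IndepSet_iff_Indep] at h
    exact (ProbabilityTheory.IndepFun_iff_Indep _ _ _).2
      (ProbabilityTheory.indep_of_indep_of_le_left
        (ProbabilityTheory.indep_of_indep_of_le_right h (hle t)) (hle s))
  · intro t
    refine ⟨(hmeas t).aemeasurable, (hmeas 0).aemeasurable, Measure.ext fun s hs => ?_⟩
    rw [Measure.map_apply (hmeas t) hs, Measure.map_apply (hmeas 0) hs,
      Set.indicator_const_preimage_eq_union, Set.indicator_const_preimage_eq_union]
    have hc : μ (A t)ᶜ = μ (A 0)ᶜ := by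
      rw [measure_compl (hA t) (measure_ne_top _ _), measure_compl (hA 0) (measure_ne_top _ _),
        hμ t 0]
    split_ifs <;> simp [hμ t 0, hc]

/-- If `u` has Cesàro limit `c r` along each residue class `r` modulo `L`, then its Cesàro limit
is the average of the `c r`. -/
theorem tendsto_cesaro_of_residues {L : ℕ} (hL : 0 < L) {u : ℕ → ℝ} (hu : ∀ i, |u i| ≤ 1)
    {c : ℕ → ℝ} (h : ∀ r < L, Tendsto
      (fun n : ℕ => (∑ t ∈ Finset.range n, u (t * L + r)) / n) atTop (𝓝 (c r))) :
    Tendsto (fun n : ℕ => (∑ i ∈ Finset.range n, u i) / n) atTop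
      (𝓝 ((∑ r ∈ Finset.range L, c r) / L)) := by
  have hL' : (0 : ℝ) < L := by exact_mod_cast hL
  have hsum : ∀ n : ℕ, ∑ i ∈ Finset.range (n * L), u i =
      ∑ r ∈ Finset.range L, ∑ t ∈ Finset.range n, u (t * L + r) := by
    intro n
    rw [Finset.sum_comm]
    induction n with
    | zero => simp
    | succ n ih =>
      rw [Nat.succ_mul, Finset.sum_range_add, Finset.sum_range_succ, ih]
  have hfull : Tendsto (fun n : ℕ => (∑ i ∈ Finset.range (n * L), u i) / n) atTop
      (𝓝 (∑ r ∈ Finset.range L, c r)) := by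
    simp_rw [hsum, Finset.sum_div]
    exact tendsto_finsetSum _ fun r hr => by
      simpa only [Finset.sum_div] using h r (Finset.mem_range.1 hr)
  have hdiv : Tendsto (fun n : ℕ => n / L) atTop atTop :=
    Nat.tendsto_div_const_atTop hL.ne'
  have hratio : Tendsto (fun n : ℕ => ((n / L : ℕ) : ℝ) / n) atTop (𝓝 (L : ℝ)⁻¹) := by
    have h1 := (tendsto_nat_floor_div_atTop (R := ℝ)).comp
      (tendsto_natCast_atTop_atTop.atTop_div_const (r := (L : ℝ)) hL' :
        Tendsto (fun n : ℕ => (n : ℝ) / L) atTop atTop)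
    have h2 := h1.mul_const (L : ℝ)⁻¹
    rw [one_mul] at h2
    refine h2.congr fun n => ?_
    simp only [Function.comp, Nat.floor_div_eq_div]
    field_simp
  have hmain := (hfull.comp hdiv).mul hratio
  have herr : Tendsto (fun n : ℕ => (∑ i ∈ Finset.range (n % L), u (n / L * L + i)) / n) atTop
      (𝓝 0) := by
    refine squeeze_zero_norm (fun n => ?_) (tendsto_const_div_atTop_nhds_zero_nat (L : ℝ))
    rw [norm_div, Real.norm_natCast]
    gcongr
    refine (norm_sum_le_of_le _ fun i _ => hu _).trans ?_
    simpa using (Nat.mod_lt n hL).le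
  rw [div_eq_mul_inv]
  have := hmain.add herr
  rw [add_zero] at this
  refine this.congr' ?_
  filter_upwards [eventually_ge_atTop L] with n hn
  have hq : 0 < n / L := Nat.div_pos hn hL
  have hq' : ((n / L : ℕ) : ℝ) ≠ 0 := by exact_mod_cast hq.ne'
  have hn' : (n : ℝ) ≠ 0 := by
    have := hL.trans_le hn
    positivity
  conv_rhs => rw [← Nat.div_add_mod' n L, Finset.sum_range_add, Nat.div_add_mod' n L]
  simp only [Function.comp]
  field_simp

/-- The closed subgroup of digit sequences whose digits sum to zero modulo `b` over each window
`[t (a + k + 1) + a, t (a + k + 1) + a + k]`. -/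
def zeroSumSubgroup (b a k : ℕ) [NeZero b] : AddSubgroup (ℕ → Fin b) where
  carrier := {x | ∀ t, ∑ j ∈ Finset.range (k + 1), x (t * (a + k + 1) + a + j) = 0}
  add_mem' hx hy t := by simp [Finset.sum_add_distrib, hx t, hy t]
  zero_mem' t := by simp
  neg_mem' hx t := by simp [Finset.sum_neg_distrib, hx t]

theorem mem_zeroSumSubgroup {b a k : ℕ} [NeZero b] {x : ℕ → Fin b} :
    x ∈ zeroSumSubgroup b a k ↔
      ∀ t, ∑ j ∈ Finset.range (k + 1), x (t * (a + k + 1) + a + j) = 0 := Iff.rfl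

theorem isClosed_zeroSumSubgroup (b a k : ℕ) [NeZero b] :
    IsClosed (zeroSumSubgroup b a k : Set (ℕ → Fin b)) := by
  have h : (zeroSumSubgroup b a k : Set (ℕ → Fin b)) =
      ⋂ t, {x | ∑ j ∈ Finset.range (k + 1), x (t * (a + k + 1) + a + j) = 0} := by
    ext x
    simp [mem_zeroSumSubgroup]
  rw [h]
  exact isClosed_iInter fun t => isClosed_eq (by fun_prop) continuous_const

/-- Digits can be prescribed freely on a set containing none of the constrained windows. -/
theorem exists_mem_zeroSumSubgroup {b a k : ℕ} [NeZero b] {F : Finset ℕ}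
    (hF : ∀ t, ∃ j ≤ k, t * (a + k + 1) + a + j ∉ F) (B : ℕ → Fin b) :
    ∃ x ∈ zeroSumSubgroup b a k, ∀ i ∈ F, x i = B i := by
  choose q hq hqF using hF
  set L := a + k + 1 with hL
  refine ⟨fun i => if i = i / L * L + a + q (i / L) then
    -∑ j ∈ (Finset.range (k + 1)).erase (q (i / L)), B (i / L * L + a + j) else B i, ?_, ?_⟩
  · rw [mem_zeroSumSubgroup, ← hL]
    intro t
    have hdiv : ∀ j ≤ k, (t * L + a + j) / L = t := fun j hj => by
      rw [add_assoc, Nat.mul_comm, Nat.mul_add_div (by omega), Nat.div_eq_of_lt (by omega),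
        add_zero]
    rw [← Finset.add_sum_erase _ _ (Finset.mem_range.2 (Nat.lt_succ_of_le (hq t)))]
    simp only [hdiv _ (hq t), if_true]
    rw [neg_add_eq_zero]
    refine Finset.sum_congr rfl fun j hj => ?_
    rw [Finset.mem_erase, Finset.mem_range] at hj
    rw [hdiv j (by omega), if_neg (by omega)]
  · intro i hi
    have : ¬ i = i / L * L + a + q (i / L) := fun h => hqF (i / L) (h ▸ hi)
    simp only [if_neg this]

theorem exists_zeroSum_measure (b a k : ℕ) [NeZero b] :
    ∃ μ : Measure (ℕ → Fin b), IsProbabilityMeasure μ ∧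
      (∀ᵐ x ∂μ, x ∈ zeroSumSubgroup b a k) ∧
      ∀ F : Finset ℕ, (∀ t, ∃ j ≤ k, t * (a + k + 1) + a + j ∉ F) → ∀ B : ℕ → Fin b,
        μ.real {x | ∀ i ∈ F, x i = B i} = ((b : ℝ) ^ F.card)⁻¹ := by
  set H := zeroSumSubgroup b a k with hH
  have : CompactSpace H := isCompact_iff_compactSpace.1 (isClosed_zeroSumSubgroup b a k).isCompact
  set ν : Measure H := Measure.addHaarMeasure ⊤ with hν
  have : IsProbabilityMeasure ν := ⟨by
    simpa using Measure.addHaarMeasure_self (K₀ := (⊤ : TopologicalSpace.PositiveCompacts H))⟩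
  have hmeas : ∀ (F : Finset ℕ) (B : ℕ → Fin b),
      MeasurableSet {x : ℕ → Fin b | ∀ i ∈ F, x i = B i} := by
    intro F B
    have : {x : ℕ → Fin b | ∀ i ∈ F, x i = B i} = ⋂ i ∈ F, {x | x i = B i} := by ext; simp
    rw [this]
    exact Finset.measurableSet_biInter _ fun i _ =>
      measurableSet_eq_fun (measurable_pi_apply i) measurable_const
  refine ⟨ν.map (↑), Measure.isProbabilityMeasure_map measurable_subtype_coe.aemeasurable, ?_, ?_⟩
  · refine (ae_map_iff measurable_subtype_coe.aemeasurable
      (isClosed_zeroSumSubgroup b a k).measurableSet).2 ?_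
    exact Eventually.of_forall fun x => x.2
  intro F hF B
  rw [map_measureReal_apply measurable_subtype_coe (hmeas F B)]
  have htrans : ∀ C : F → Fin b,
      ν.real ((fun x : H => F.restrict (x : ℕ → Fin b)) ⁻¹' {C}) =
        ν.real ((fun x : H => (x : ℕ → Fin b)) ⁻¹' {x | ∀ i ∈ F, x i = B i}) := by
    intro C
    obtain ⟨y, hy, hyF⟩ := exists_mem_zeroSumSubgroup hF
      (fun i => if h : i ∈ F then C ⟨i, h⟩ - B i else 0)
    rw [measureReal_def, measureReal_def, ← measure_preimage_add ν ⟨y, hy⟩]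
    congr 2
    ext x
    simp only [Set.mem_preimage, Set.mem_singleton_iff, funext_iff, Set.mem_ofPred_eq,
      Finset.restrict, Subtype.forall, AddSubgroup.coe_add, Pi.add_apply]
    refine forall₂_congr fun i hi => ?_
    rw [hyF i hi, dif_pos hi, sub_add_eq_add_sub, sub_eq_iff_eq_add, add_right_inj]
  have hrm : Measurable fun x : H => F.restrict (x : ℕ → Fin b) :=
    (Finset.measurable_restrict F).comp measurable_subtype_coe
  have hsum := sum_measureReal_preimage_singleton (μ := ν) (Finset.univ : Finset (F → Fin b))
    (f := fun x : H => F.restrict (x : ℕ → Fin b))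
    (fun C _ => hrm (MeasurableSet.singleton C))
  rw [Finset.sum_congr rfl fun C _ => htrans C] at hsum
  simp only [Finset.sum_const, Finset.card_univ, Fintype.card_fun, Fintype.card_fin,
    Fintype.card_coe, Finset.coe_univ, Set.preimage_univ, probReal_univ, nsmul_eq_mul,
    Nat.cast_pow] at hsum
  exact eq_inv_of_mul_eq_one_right hsum

theorem ae_tendsto_window_frequency {b a k m r : ℕ} [NeZero b] {μ : Measure (ℕ → Fin b)}
    [IsProbabilityMeasure μ]
    (hμ : ∀ F : Finset ℕ, (∀ t, ∃ j ≤ k, t * (a + k + 1) + a + j ∉ F) → ∀ B : ℕ → Fin b,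
      μ.real {x | ∀ i ∈ F, x i = B i} = ((b : ℝ) ^ F.card)⁻¹)
    (hm : m < a + k + 1)
    (hr : ∀ s t, ∃ j ≤ k, t * (a + k + 1) + a + j ∉
      Finset.Ico (s * (a + k + 1) + r) (s * (a + k + 1) + r + m))
    (B : Fin m → Fin b) :
    ∀ᵐ x ∂μ, Tendsto (fun n : ℕ => (∑ t ∈ Finset.range n,
      {x : ℕ → Fin b | ∀ j : Fin m, x (t * (a + k + 1) + r + j) = B j}.indicator
        (fun _ => (1 : ℝ)) x) / n) atTop (𝓝 ((b : ℝ) ^ m)⁻¹) := by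
  set L := a + k + 1 with hL
  let C : ℕ → ℕ → Fin b := fun n i => if h : i - n < m then B ⟨i - n, h⟩ else 0
  have hwin : ∀ n (x : ℕ → Fin b), (∀ j : Fin m, x (n + j) = B j) ↔
      ∀ i ∈ Finset.Ico n (n + m), x i = C n i := by
    intro n x
    constructor
    · intro h i hi
      rw [Finset.mem_Ico] at hi
      have hlt : i - n < m := by omega
      have := h ⟨i - n, hlt⟩
      simp only [Nat.add_sub_cancel' hi.1] at this
      simp only [C, dif_pos hlt, this]
    · intro h j
      have := h (n + j) (Finset.mem_Ico.2 ⟨by omega, by omega⟩)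
      simpa [C] using this
  refine ae_tendsto_frequency (fun t => ?_) (fun t => ?_) (fun s t hst => ?_)
  · rw [Set.ofPred_forall]
    exact MeasurableSet.iInter fun j =>
      measurableSet_eq_fun (measurable_pi_apply _) measurable_const
  · simp_rw [hwin]
    rw [hμ _ (hr t), Nat.card_Ico, Nat.add_sub_cancel_left]
  · have hgap : s * L + L ≤ t * L ∨ t * L + L ≤ s * L := by
      rcases Nat.lt_or_gt_of_ne hst with h | h
      · left; rw [← Nat.succ_mul]; exact Nat.mul_le_mul_right _ h
      · right; rw [← Nat.succ_mul]; exact Nat.mul_le_mul_right _ h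
    have hdisj : Disjoint (Finset.Ico (s * L + r) (s * L + r + m))
        (Finset.Ico (t * L + r) (t * L + r + m)) := by
      rw [Finset.disjoint_left]
      intro i hi hi'
      rw [Finset.mem_Ico] at hi hi'
      omega
    have hinter : {x : ℕ → Fin b | ∀ j : Fin m, x (s * L + r + j) = B j} ∩
        {x : ℕ → Fin b | ∀ j : Fin m, x (t * L + r + j) = B j} =
        {x | ∀ i ∈ Finset.Ico (s * L + r) (s * L + r + m) ∪
          Finset.Ico (t * L + r) (t * L + r + m), x i =
          if i ∈ Finset.Ico (s * L + r) (s * L + r + m) then C (s * L + r) i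
          else C (t * L + r) i} := by
      ext x
      simp only [Set.mem_inter_iff, Set.mem_ofPred_eq, hwin, Finset.mem_union, or_imp, forall_and]
      refine and_congr (forall₂_congr fun i hi => by rw [if_pos hi]) (forall₂_congr fun i hi => ?_)
      rw [if_neg (Finset.disjoint_right.1 hdisj hi)]
    rw [hinter, hμ, Finset.card_union_of_disjoint hdisj, Nat.card_Ico, Nat.card_Ico,
      Nat.add_sub_cancel_left, Nat.add_sub_cancel_left, pow_add, mul_inv]
    intro u
    obtain ⟨j₁, hj₁, h₁⟩ := hr s u
    obtain ⟨j₂, hj₂, h₂⟩ := hr t u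
    by_contra! hall
    have h₁' := hall j₁ hj₁
    have h₂' := hall j₂ hj₂
    simp only [Finset.mem_union, Finset.mem_Ico] at h₁ h₂ h₁' h₂' hall
    rcases hgap with h | h
    · have := hall (s * L + r + m - (u * L + a)) (by omega)
      omega
    · have := hall (t * L + r + m - (u * L + a)) (by omega)
      omega

/-- The block `B` occurs in the digit sequence `x` with asymptotic frequency `p`. -/
def HasBlockFrequency {b m : ℕ} (x : ℕ → Fin b) (B : Fin m → Fin b) (p : ℝ) : Prop :=
  Tendsto (fun n : ℕ =>
    (((Finset.range n).filter fun i => ∀ j : Fin m, x (i + j) = B j).card : ℝ) / n) atTop (𝓝 p)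

theorem ae_hasBlockFrequency_of_residues {b m L : ℕ} (hL : 0 < L) {μ : Measure (ℕ → Fin b)}
    {B : Fin m → Fin b} {c : ℕ → ℝ} (h : ∀ r < L, ∀ᵐ x ∂μ, Tendsto (fun n : ℕ =>
      (∑ t ∈ Finset.range n, {x : ℕ → Fin b | ∀ j : Fin m, x (t * L + r + j) = B j}.indicator
        (fun _ => (1 : ℝ)) x) / n) atTop (𝓝 (c r))) :
    ∀ᵐ x ∂μ, HasBlockFrequency x B ((∑ r ∈ Finset.range L, c r) / L) := by
  filter_upwards [(ae_ball_iff (Set.to_countable (Set.Iio L))).2 h] with x hx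
  have := tendsto_cesaro_of_residues hL
    (u := fun i => {x : ℕ → Fin b | ∀ j : Fin m, x (i + j) = B j}.indicator
        (fun _ => (1 : ℝ)) x)
    (fun i => by rw [Set.indicator_apply]; split_ifs <;> simp) hx
  refine this.congr fun n => ?_
  simp only [Set.indicator_apply, Set.mem_ofPred_eq, Finset.sum_boole]

theorem ae_hasBlockFrequency {b a k : ℕ} [NeZero b] (ha : 1 ≤ a) {μ : Measure (ℕ → Fin b)}
    [IsProbabilityMeasure μ]
    (hμ : ∀ F : Finset ℕ, (∀ t, ∃ j ≤ k, t * (a + k + 1) + a + j ∉ F) → ∀ B : ℕ → Fin b,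
      μ.real {x | ∀ i ∈ F, x i = B i} = ((b : ℝ) ^ F.card)⁻¹) (B : Fin k → Fin b) :
    ∀ᵐ x ∂μ, HasBlockFrequency x B ((b : ℝ) ^ k)⁻¹ := by
  have := ae_hasBlockFrequency_of_residues (by omega) fun r _ =>
    ae_tendsto_window_frequency hμ (m := k) (r := r) (by omega) (fun s t => by
      by_contra! hall
      have h₁ := hall 0 (by omega)
      have h₂ := hall k le_rfl
      simp only [Finset.mem_Ico] at h₁ h₂
      omega) B
  convert this using 3
  rw [Finset.sum_const, Finset.card_range, nsmul_eq_mul, mul_div_cancel_left₀]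
  positivity

theorem ae_hasBlockFrequency_zero {b a k : ℕ} [NeZero b] (ha : 1 ≤ a) {μ : Measure (ℕ → Fin b)}
    [IsProbabilityMeasure μ] (hμ₀ : ∀ᵐ x ∂μ, x ∈ zeroSumSubgroup b a k)
    (hμ : ∀ F : Finset ℕ, (∀ t, ∃ j ≤ k, t * (a + k + 1) + a + j ∉ F) → ∀ B : ℕ → Fin b,
      μ.real {x | ∀ i ∈ F, x i = B i} = ((b : ℝ) ^ F.card)⁻¹) :
    ∀ᵐ x ∂μ, HasBlockFrequency x (0 : Fin (k + 1) → Fin b)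
      ((∑ r ∈ Finset.range (a + k + 1),
        if r = a then ((b : ℝ) ^ k)⁻¹ else ((b : ℝ) ^ (k + 1))⁻¹) / (a + k + 1 : ℕ)) := by
  refine ae_hasBlockFrequency_of_residues (by omega) fun r hr => ?_
  split_ifs with hra
  · subst hra
    have := ae_tendsto_window_frequency hμ (m := k) (r := r) (by omega) (fun s t => by
      by_contra! hall
      have h₁ := hall 0 (by omega)
      have h₂ := hall k le_rfl
      simp only [Finset.mem_Ico] at h₁ h₂
      omega) 0
    filter_upwards [this, hμ₀] with x hx hx₀
    refine hx.congr fun n => ?_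
    congr 1
    refine Finset.sum_congr rfl fun t _ => ?_
    simp only [Set.indicator_apply, Set.mem_ofPred_eq, Pi.zero_apply]
    refine if_congr ?_ rfl rfl
    have hsum := mem_zeroSumSubgroup.1 hx₀ t
    rw [Fin.forall_fin_succ']
    simp only [Fin.val_castSucc, Fin.val_last]
    refine ⟨fun h => ⟨h, ?_⟩, fun h => h.1⟩
    rw [Finset.sum_range_succ, Finset.sum_eq_zero, zero_add] at hsum
    · exact hsum
    · exact fun j hj => h ⟨j, Finset.mem_range.1 hj⟩
  · refine ae_tendsto_window_frequency hμ (m := k + 1) (r := r) (by omega) (fun s t => ?_) 0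
    by_contra! hall
    have h₁ := hall 0 (by omega)
    have h₂ := hall k le_rfl
    simp only [Finset.mem_Ico] at h₁ h₂
    have heq : t * (a + k + 1) + a = s * (a + k + 1) + r := by omega
    have hmod := congrArg (· % (a + k + 1)) heq
    simp only [Nat.mul_add_mod', Nat.mod_eq_of_lt hr,
      Nat.mod_eq_of_lt (show a < a + k + 1 by omega)] at hmod
    exact hra hmod.symm

/-- The integer with base `b` digits `x 0, …, x (n - 1)`, most significant first. -/
def digitPrefix {b : ℕ} (x : ℕ → Fin b) : ℕ → ℕ
  | 0 => 0
  | n + 1 => b * digitPrefix x n + x n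

theorem eq_of_digitPrefix_eq {b : ℕ} {x y : ℕ → Fin b} {n : ℕ}
    (h : digitPrefix x n = digitPrefix y n) : ∀ i < n, x i = y i := by
  induction n with
  | zero => simp
  | succ n ih =>
    simp only [digitPrefix] at h
    have hb : 0 < b := Fin.pos (x 0)
    have hdiv := congrArg (· / b) h
    have hmod := congrArg (· % b) h
    simp only [Nat.mul_add_div hb, Nat.div_eq_of_lt (Fin.is_lt _), add_zero,
      Nat.mul_add_mod, Nat.mod_eq_of_lt (Fin.is_lt _)] at hdiv hmod
    intro i hi
    rcases Nat.lt_succ_iff_lt_or_eq.1 hi with hi | rfl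
    · exact ih hdiv i hi
    · exact Fin.ext hmod

theorem digitPrefix_lt {b : ℕ} (x : ℕ → Fin b) (n : ℕ) : digitPrefix x n + 1 ≤ b ^ n := by
  induction n with
  | zero => simp [digitPrefix]
  | succ n ih =>
    have := Nat.mul_le_mul_left b ih
    have := (x n).is_lt
    rw [digitPrefix, pow_succ']
    lia

theorem mul_ofDigits {b : ℕ} (x : ℕ → Fin b) :
    b * Real.ofDigits x = (x 0 : ℕ) + Real.ofDigits fun i => x (i + 1) := by
  have hb : (b : ℝ) ≠ 0 := by exact_mod_cast (Fin.pos (x 0)).ne'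
  rw [Real.ofDigits_eq_sum_add_ofDigits x 1]
  simp only [Finset.sum_range_one, Real.ofDigitsTerm]
  field_simp
  ring

theorem pow_mul_ofDigits {b : ℕ} (x : ℕ → Fin b) (n : ℕ) :
    (b : ℝ) ^ n * Real.ofDigits x = digitPrefix x n + Real.ofDigits fun i => x (i + n) := by
  induction n with
  | zero => simp [digitPrefix]
  | succ n ih =>
    rw [pow_succ', mul_assoc, ih, mul_add, mul_ofDigits, digitPrefix]
    push_cast
    simp only [zero_add, add_right_comm _ 1 n, add_assoc]

theorem ofDigits_lt_one {b : ℕ} {x : ℕ → Fin b} {n : ℕ} (hn : (x n : ℕ) + 1 < b) :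
    Real.ofDigits x < 1 := by
  have hpre : digitPrefix x (n + 1) + 2 ≤ b ^ (n + 1) := by
    have := Nat.mul_le_mul_left b (digitPrefix_lt x n)
    rw [digitPrefix, pow_succ']
    lia
  have h := pow_mul_ofDigits x (n + 1)
  have hle := Real.ofDigits_le_one fun i => x (i + (n + 1))
  have hpre' : (digitPrefix x (n + 1) : ℝ) + 2 ≤ (b : ℝ) ^ (n + 1) := by exact_mod_cast hpre
  have hpos : (0 : ℝ) < (b : ℝ) ^ (n + 1) := by
    have : 0 < b := Fin.pos (x 0)
    positivity
  by_contra! hge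
  nlinarith

theorem qdigit_ofDigits {b : ℕ} {x : ℕ → Fin b} (hx : ∀ N, ∃ n ≥ N, (x n : ℕ) + 1 < b) (n : ℕ) :
    qdigit (fun _ => b) (Real.ofDigits x) n = x n := by
  have hlt : ∀ N, Real.ofDigits (fun i => x (i + N)) < 1 := fun N => by
    obtain ⟨m, hm, h⟩ := hx N
    exact ofDigits_lt_one (n := m - N) (by simpa [Nat.sub_add_cancel hm] using h)
  rw [qdigit, TQ, qprod, Finset.prod_const, Finset.card_range, pow_mul_ofDigits,
    Int.fract_natCast_add, Int.fract_eq_self.2 ⟨Real.ofDigits_nonneg _, hlt n⟩, mul_ofDigits,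
    add_comm, Nat.floor_add_natCast (Real.ofDigits_nonneg _), Nat.floor_eq_zero.2]
  · simp
  · simpa only [add_assoc, add_comm 1 n] using hlt (n + 1)

theorem HasBlockFrequency.exists_eq_zero {b k : ℕ} [NeZero b] (hk : 1 ≤ k) {x : ℕ → Fin b}
    {p : ℝ} (hp : p ≠ 0) (h : HasBlockFrequency x (0 : Fin k → Fin b) p) (N : ℕ) :
    ∃ n ≥ N, x n = 0 := by
  by_contra! hne
  refine hp (tendsto_nhds_unique h ?_)
  refine squeeze_zero (fun n => by positivity) (fun n => ?_)
    (tendsto_const_div_atTop_nhds_zero_nat (N : ℝ))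
  gcongr
  rw [← Finset.card_range N]
  refine Finset.card_le_card fun i hi => ?_
  rw [Finset.mem_filter] at hi
  rw [Finset.mem_range]
  by_contra! hN
  exact hne i hN (hi.2 ⟨0, hk⟩)

theorem blockCount_ofDigits {b m : ℕ} {x : ℕ → Fin b} (hx : ∀ N, ∃ n ≥ N, (x n : ℕ) + 1 < b)
    (B : Fin m → Fin b) (n : ℕ) :
    blockCount (fun _ => b) (Real.ofDigits x) (fun j => (B j : ℕ)) n =
      ((Finset.range n).filter fun i => ∀ j : Fin m, x (i + j) = B j).card := by
  simp only [blockCount, qdigit_ofDigits hx, Fin.val_inj]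

theorem ofDigits_mem_diff {b k : ℕ} [NeZero b] (hb : 2 ≤ b) (hk : 1 ≤ k) {x : ℕ → Fin b} {p : ℝ}
    (hx : ∀ B : Fin k → Fin b, HasBlockFrequency x B ((b : ℝ) ^ k)⁻¹)
    (hx₀ : HasBlockFrequency x (0 : Fin (k + 1) → Fin b) p) (hp : p ≠ ((b : ℝ) ^ (k + 1))⁻¹) :
    Real.ofDigits x ∈ BaseNormalOfOrder b k \ BaseNormalOfOrder b (k + 1) := by
  have hdig : ∀ N, ∃ n ≥ N, (x n : ℕ) + 1 < b := fun N => by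
    obtain ⟨n, hn, h⟩ := (hx 0).exists_eq_zero hk (by positivity) N
    exact ⟨n, hn, by rw [h]; simp; omega⟩
  refine ⟨fun B hB => ?_, fun hmem => hp ?_⟩
  · simpa only [HasBlockFrequency, ← blockCount_ofDigits hdig] using hx fun j => ⟨B j, hB j⟩
  · have h := hmem (fun j => ((0 : Fin (k + 1) → Fin b) j : ℕ)) fun j => Fin.is_lt _
    simp only [blockCount_ofDigits hdig] at h
    exact tendsto_nhds_unique hx₀ h

/-- A mass distribution principle on the real line. -/
theorem le_dimH_of_measureReal_Icc_le {ν : Measure ℝ} [IsFiniteMeasure ν] {C r : ℝ} (hC : 0 < C)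
    (hr : 0 < r)
    (h : ∀ u δ : ℝ, 0 < δ → δ ≤ 1 → ν.real (Set.Icc u (u + δ)) ≤ C * δ ^ r)
    {s : Set ℝ} (hs : ν s ≠ 0) : ENNReal.ofReal r ≤ dimH s := by
  set K : ENNReal := ENNReal.ofReal (C * 2 ^ r) with hK
  have hK₀ : K ≠ 0 := by
    rw [hK, Ne, ENNReal.ofReal_eq_zero, not_le]
    positivity
  have hle : ∀ t : Set ℝ, Metric.ediam t ≤ ENNReal.ofReal (1 / 4) →
      ν t ≤ K * Metric.ediam t ^ r := by
    intro t ht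
    rcases t.eq_empty_or_nonempty with rfl | ⟨u, hu⟩
    · simp
    have htop : Metric.ediam t ≠ ⊤ := ne_top_of_le_ne_top ENNReal.ofReal_ne_top ht
    have hdiam : Metric.diam t ≤ 1 / 4 := ENNReal.toReal_le_of_le_ofReal (by norm_num) ht
    have hd₀ : 0 ≤ Metric.diam t := Metric.diam_nonneg
    have hbound : ν.real t ≤ C * (2 * Metric.diam t) ^ r := by
      have hcont : Tendsto (fun δ : ℝ => C * (2 * δ) ^ r) (𝓝[>] Metric.diam t)
          (𝓝 (C * (2 * Metric.diam t) ^ r)) := by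
        refine ContinuousAt.tendsto ?_ |>.mono_left nhdsWithin_le_nhds
        exact continuousAt_const.mul
          ((continuousAt_const.mul continuousAt_id).rpow_const (Or.inr hr.le))
      refine ge_of_tendsto hcont ?_
      filter_upwards [Ioc_mem_nhdsGT (show Metric.diam t < 1 / 2 by linarith)] with δ hδ
      have hδ₀ : 0 < δ := hd₀.trans_lt hδ.1
      refine (measureReal_mono fun v hv => ?_).trans
        (h (u - δ) (2 * δ) (by positivity) (by linarith [hδ.2]))
      have hdist := Metric.dist_le_diam_of_mem' htop hv hu
      rw [Real.dist_eq, abs_le] at hdist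
      constructor <;> linarith [hδ.1, hdist.1, hdist.2]
    have hediam : Metric.ediam t = ENNReal.ofReal (Metric.diam t) :=
      (ENNReal.ofReal_toReal htop).symm
    rw [hediam, ENNReal.ofReal_rpow_of_nonneg hd₀ hr.le, hK, ← ENNReal.ofReal_mul (by positivity),
      mul_assoc, ← Real.mul_rpow zero_le_two hd₀, ← ofReal_measureReal (measure_ne_top ν t)]
    exact ENNReal.ofReal_le_ofReal hbound
  have hH : K⁻¹ • ν ≤ μH[r] :=
    Measure.le_hausdorffMeasure r _ (ENNReal.ofReal (1 / 4)) (by simp) fun t ht => by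
      rw [Measure.smul_apply, smul_eq_mul, ENNReal.inv_mul_le_iff hK₀ ENNReal.ofReal_ne_top]
      exact hle t ht
  have hne : μH[(r.toNNReal : ℝ)] s ≠ 0 := by
    rw [Real.coe_toNNReal r hr.le]
    refine ne_of_gt (lt_of_lt_of_le ?_ (hH s))
    rw [Measure.smul_apply, smul_eq_mul]
    exact ENNReal.mul_pos (ENNReal.inv_ne_zero.2 ENNReal.ofReal_ne_top) hs
  exact le_dimH_of_hausdorffMeasure_ne_zero hne

theorem card_filter_mod_ne_add_div (m n : ℕ) :
    ((Finset.range n).filter fun i => i % (m + 1) ≠ m).card + n / (m + 1) = n := by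
  induction n with
  | zero => simp
  | succ n ih =>
    have hiff : m + 1 ∣ n + 1 ↔ n % (m + 1) = m := by
      rw [Nat.dvd_iff_mod_eq_zero, ← Nat.mod_add_mod]
      have hle : n % (m + 1) ≤ m := Nat.lt_succ_iff.1 (Nat.mod_lt n (Nat.add_one_pos m))
      rcases hle.eq_or_lt with h | h
      · simp [h]
      · rw [Nat.mod_eq_of_lt (Nat.succ_lt_succ h)]
        omega
    rw [Finset.range_add_one, Finset.filter_insert, Nat.succ_div]
    by_cases hn : n % (m + 1) = m
    · rw [if_neg (by simpa using hn), if_pos (hiff.2 hn)]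
      omega
    · rw [if_pos hn, if_neg (by rwa [hiff]), Finset.card_insert_of_notMem (by simp)]
      omega

theorem measureReal_map_ofDigits_Icc_le {b a k : ℕ} [NeZero b] (hb : 2 ≤ b)
    {μ : Measure (ℕ → Fin b)} [IsProbabilityMeasure μ]
    (hμ : ∀ F : Finset ℕ, (∀ t, ∃ j ≤ k, t * (a + k + 1) + a + j ∉ F) → ∀ B : ℕ → Fin b,
      μ.real {x | ∀ i ∈ F, x i = B i} = ((b : ℝ) ^ F.card)⁻¹) (u : ℝ) {δ : ℝ}
    (hδ₀ : 0 < δ) (hδ₁ : δ ≤ 1) :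
    (μ.map Real.ofDigits).real (Set.Icc u (u + δ)) ≤
      3 * (b : ℝ) ^ (1 - 1 / ((a + k + 1 : ℕ) : ℝ)) * δ ^ (1 - 1 / ((a + k + 1 : ℕ) : ℝ)) := by
  set r : ℝ := 1 - 1 / ((a + k + 1 : ℕ) : ℝ) with hr
  have hr₀ : 0 ≤ r := by
    rw [hr, sub_nonneg]
    exact div_le_one_of_le₀ (by exact_mod_cast (by omega : 1 ≤ a + k + 1)) (by positivity)
  have hb₁ : (1 : ℝ) < b := by exact_mod_cast hb
  have hb₀ : (0 : ℝ) < b := by linarith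
  obtain ⟨n, hn₁, hn₂⟩ := exists_nat_pow_near_of_lt_one hδ₀ hδ₁ (inv_pos.2 hb₀)
    (inv_lt_one_of_one_lt₀ hb₁)
  set F : Finset ℕ := (Finset.range n).filter fun i => i % (a + k + 1) ≠ a + k with hF
  have hcyl : ∀ N : ℤ, μ.real {x : ℕ → Fin b | (digitPrefix x n : ℤ) = N} ≤
      ((b : ℝ) ^ F.card)⁻¹ := by
    intro N
    rcases Set.eq_empty_or_nonempty {x : ℕ → Fin b | (digitPrefix x n : ℤ) = N} with h | ⟨y, hy⟩
    · rw [h, measureReal_empty]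
      positivity
    · rw [← hμ F (fun t => ⟨k, le_rfl, ?_⟩) y]
      · refine measureReal_mono fun x hx i hi => ?_
        have hxy : (digitPrefix x n : ℤ) = digitPrefix y n :=
          (show (digitPrefix x n : ℤ) = N from hx).trans hy.symm
        exact eq_of_digitPrefix_eq (by exact_mod_cast hxy) i
          (Finset.mem_range.1 (Finset.mem_filter.1 hi).1)
      · rw [hF, Finset.mem_filter, add_assoc, Nat.mul_add_mod',
          Nat.mod_eq_of_lt (by omega)]
        simp
  have hcover : Real.ofDigits ⁻¹' Set.Icc u (u + δ) ⊆
      ⋃ N ∈ Finset.Icc ⌈(b : ℝ) ^ n * u - 1⌉ (⌈(b : ℝ) ^ n * u - 1⌉ + 2),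
        {x : ℕ → Fin b | (digitPrefix x n : ℤ) = N} := by
    intro x hx
    have hpow : (0 : ℝ) < (b : ℝ) ^ n := by positivity
    have heq := pow_mul_ofDigits x n
    have ht₀ := Real.ofDigits_nonneg fun i => x (i + n)
    have ht₁ := Real.ofDigits_le_one fun i => x (i + n)
    have h₁ := mul_le_mul_of_nonneg_left hx.1 hpow.le
    have h₂ := mul_le_mul_of_nonneg_left (hx.2.trans (add_le_add_right hn₂ u)) hpow.le
    rw [mul_add, inv_pow, mul_inv_cancel₀ hpow.ne'] at h₂
    have hceil := Int.le_ceil ((b : ℝ) ^ n * u - 1)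
    simp only [Set.mem_iUnion, Finset.mem_Icc, Set.mem_ofPred_eq, exists_prop, exists_eq_right']
    constructor
    · rw [Int.ceil_le]
      push_cast
      linarith
    · have : ((digitPrefix x n : ℤ) : ℝ) ≤ ((⌈(b : ℝ) ^ n * u - 1⌉ + 2 : ℤ) : ℝ) := by
        push_cast
        linarith
      exact_mod_cast this
  have hcard : (r * n : ℝ) ≤ F.card := by
    have h₁ : ((F.card + n / (a + k + 1) : ℕ) : ℝ) = n := by
      exact_mod_cast card_filter_mod_ne_add_div (a + k) n
    have h₂ : ((n / (a + k + 1) : ℕ) : ℝ) ≤ n / (a + k + 1 : ℕ) := Nat.cast_div_le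
    push_cast at h₁ h₂ ⊢
    rw [hr, sub_mul, one_mul, one_div_mul_eq_div]
    push_cast
    linarith
  have hpow : ((b : ℝ) ^ F.card)⁻¹ ≤ ((b : ℝ) * δ) ^ r := by
    calc ((b : ℝ) ^ F.card)⁻¹ ≤ ((b : ℝ) ^ (r * n))⁻¹ := by
          rw [← Real.rpow_natCast]
          gcongr
          exact hb₁.le
      _ = ((b : ℝ)⁻¹ ^ n) ^ r := by
          rw [mul_comm, Real.rpow_mul hb₀.le, Real.rpow_natCast, inv_pow,
            Real.inv_rpow (by positivity)]
      _ ≤ ((b : ℝ) * δ) ^ r := by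
          refine Real.rpow_le_rpow (by positivity) ?_ hr₀
          rw [pow_succ, ← div_eq_mul_inv, div_lt_iff₀ hb₀] at hn₁
          linarith
  rw [map_measureReal_apply Real.continuous_ofDigits.measurable measurableSet_Icc]
  calc μ.real (Real.ofDigits ⁻¹' Set.Icc u (u + δ))
      ≤ ∑ N ∈ Finset.Icc ⌈(b : ℝ) ^ n * u - 1⌉ (⌈(b : ℝ) ^ n * u - 1⌉ + 2),
          μ.real {x : ℕ → Fin b | (digitPrefix x n : ℤ) = N} :=
        (measureReal_mono hcover (measure_ne_top _ _)).trans (measureReal_biUnion_finset_le _ _)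
    _ ≤ 3 * ((b : ℝ) ^ F.card)⁻¹ := by
        refine (Finset.sum_le_card_nsmul _ _ _ fun N _ => hcyl N).trans_eq ?_
        rw [Int.card_Icc, nsmul_eq_mul]
        have : (⌈(b : ℝ) ^ n * u - 1⌉ + 2 + 1 - ⌈(b : ℝ) ^ n * u - 1⌉).toNat = 3 := by omega
        rw [this, Nat.cast_ofNat]
    _ ≤ 3 * (b : ℝ) ^ r * δ ^ r := by
        rw [mul_assoc, ← Real.mul_rpow hb₀.le hδ₀.le]
        gcongr

theorem le_dimH_normal_diff {b k : ℕ} (hb : 2 ≤ b) (hk : 1 ≤ k) {a : ℕ} (ha : 1 ≤ a) :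
    ENNReal.ofReal (1 - 1 / ((a + k + 1 : ℕ) : ℝ)) ≤
      dimH (BaseNormalOfOrder b k \ BaseNormalOfOrder b (k + 1)) := by
  have : NeZero b := ⟨by omega⟩
  have hb₁ : (1 : ℝ) < b := by exact_mod_cast hb
  obtain ⟨μ, hprob, hμ₀, hμ⟩ := exists_zeroSum_measure b a k
  have hmap : IsProbabilityMeasure (μ.map Real.ofDigits) :=
    Measure.isProbabilityMeasure_map Real.continuous_ofDigits.aemeasurable
  refine le_dimH_of_measureReal_Icc_le (ν := μ.map Real.ofDigits) (by positivity) ?_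
    (fun u δ h₀ h₁ => measureReal_map_ofDigits_Icc_le hb hμ u h₀ h₁) ?_
  · rw [sub_pos, div_lt_one (by positivity)]
    exact_mod_cast (by omega : 1 < a + k + 1)
  have hae : ∀ᵐ x ∂μ,
      Real.ofDigits x ∈ BaseNormalOfOrder b k \ BaseNormalOfOrder b (k + 1) := by
    filter_upwards [ae_all_iff.2 fun B => ae_hasBlockFrequency ha hμ B,
      ae_hasBlockFrequency_zero ha hμ₀ hμ] with x hx hx₀
    refine ofDigits_mem_diff hb hk hx hx₀ (ne_of_gt ?_)
    have hlt : ((b : ℝ) ^ (k + 1))⁻¹ < ((b : ℝ) ^ k)⁻¹ :=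
      inv_strictAnti₀ (by positivity) (pow_lt_pow_right₀ hb₁ (Nat.lt_succ_self k))
    rw [lt_div_iff₀ (by positivity), mul_comm, ← nsmul_eq_mul]
    nth_rewrite 1 [← Finset.card_range (a + k + 1)]
    rw [← Finset.sum_const]
    refine Finset.sum_lt_sum (fun r _ => ?_) ⟨a, by simp, by simpa using hlt⟩
    split_ifs
    exacts [hlt.le, le_rfl]
  refine ne_of_gt (lt_of_lt_of_le ?_
    (Measure.le_map_apply Real.continuous_ofDigits.aemeasurable _))
  rw [pos_iff_ne_zero]
  intro h
  obtain ⟨x, hx, hx'⟩ := (hae.and (measure_eq_zero_iff_ae_notMem.1 h)).exists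
  exact hx' hx

/-- For every integer `b ≥ 2` and every positive integer `k`, the set of real numbers that
are normal of order `k` in base `b` but not normal of order `k+1` in base `b` has full
Hausdorff dimension. -/
theorem stmt0 (b k : ℕ) (hb : 2 ≤ b) (hk : 1 ≤ k) :
    dimH (BaseNormalOfOrder b k \ BaseNormalOfOrder b (k + 1)) = 1 := by
  refine le_antisymm ((dimH_mono (Set.subset_univ _)).trans_eq Real.dimH_univ) ?_
  have hlim : Tendsto (fun a : ℕ => ENNReal.ofReal (1 - 1 / ((a + k + 1 : ℕ) : ℝ))) atTop
      (𝓝 1) := by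
    have h : Tendsto (fun a : ℕ => 1 - 1 / ((a + k + 1 : ℕ) : ℝ)) atTop (𝓝 (1 - 0)) :=
      tendsto_const_nhds.sub
        ((tendsto_add_atTop_iff_nat (k + 1)).2 tendsto_one_div_atTop_nhds_zero_nat)
    simpa [Function.comp_def] using (ENNReal.continuous_ofReal.tendsto _).comp h
  refine le_of_tendsto hlim ?_
  filter_upwards [eventually_ge_atTop 1] with a ha
  exact le_dimH_normal_diff hb hk ha
end

section
/- For every set S of positive integers that is almost closed under addition, there exists a fully divergent, infinite in limit basic sequence Q such that the set of real numbers that are Q-normal of every order k ∈ S but not Q-normal of any order k ∉ S has full Hausdorff dimension: dim_H(⋂_{k∈S} N_k(Q) \ ⋃_{k∉S} N_k(Q)) = 1. -/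
open Filter MeasureTheory Finset
open scoped Topology Classical

/-- The tail `∑_{j ≥ n} E_j / (q_n ⋯ q_j)` of a Cantor series. -/
noncomputable def cantorTail (q E : ℕ → ℕ) (n : ℕ) : ℝ :=
  ∑' j : ℕ, (E (n + j) : ℝ) / ∏ i ∈ Finset.range (j + 1), (q (n + i) : ℝ)

lemma two_pow_le_prod {q : ℕ → ℕ} (hq : IsBasic q) (n j : ℕ) :
    (2 : ℝ) ^ j ≤ ∏ i ∈ Finset.range j, (q (n + i) : ℝ) := by
  calc (2 : ℝ) ^ j = ∏ i ∈ Finset.range j, (2 : ℝ) := by simp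
    _ ≤ _ := Finset.prod_le_prod (fun _ _ => by norm_num)
      (fun i _ => by exact_mod_cast hq (n + i))

lemma cantorTail_term_le {q E : ℕ → ℕ} (hq : IsBasic q) (hE : ∀ n, E n < q n) (n j : ℕ) :
    (E (n + j) : ℝ) / ∏ i ∈ Finset.range (j + 1), (q (n + i) : ℝ) ≤ (1 / 2) ^ j := by
  have h1 := two_pow_le_prod hq n j
  have h2 : (E (n + j) : ℝ) ≤ q (n + j) := by exact_mod_cast (hE (n + j)).le
  have h3 : (0 : ℝ) < q (n + j) := by
    have := hq (n + j); positivity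
  have h4 : (0 : ℝ) < ∏ i ∈ Finset.range j, (q (n + i) : ℝ) := lt_of_lt_of_le (by positivity) h1
  rw [Finset.prod_range_succ, div_le_iff₀ (by positivity), one_div, inv_pow]
  have h5 : 1 ≤ (2 ^ j)⁻¹ * ∏ i ∈ Finset.range j, (q (n + i) : ℝ) := by
    rw [inv_mul_eq_div, le_div_iff₀ (by positivity)]; simpa using h1
  calc (E (n + j) : ℝ) ≤ 1 * q (n + j) := by simpa using h2
    _ ≤ ((2 ^ j)⁻¹ * ∏ i ∈ Finset.range j, (q (n + i) : ℝ)) * q (n + j) := by gcongr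
    _ = _ := by ring

lemma cantorTail_summable {q E : ℕ → ℕ} (hq : IsBasic q) (hE : ∀ n, E n < q n) (n : ℕ) :
    Summable fun j : ℕ => (E (n + j) : ℝ) / ∏ i ∈ Finset.range (j + 1), (q (n + i) : ℝ) :=
  Summable.of_nonneg_of_le (fun _ => by positivity) (cantorTail_term_le hq hE n)
    (summable_geometric_of_lt_one (by norm_num) (by norm_num))

lemma cantorTail_nonneg (q E : ℕ → ℕ) (n : ℕ) : 0 ≤ cantorTail q E n :=
  tsum_nonneg fun _ => by positivity

lemma cantorTail_le_two {q E : ℕ → ℕ} (hq : IsBasic q) (hE : ∀ n, E n < q n) (n : ℕ) :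
    cantorTail q E n ≤ 2 := by
  have := (cantorTail_summable hq hE n).tsum_le_tsum (cantorTail_term_le hq hE n)
    (summable_geometric_of_lt_one (by norm_num) (by norm_num))
  rw [tsum_geometric_of_lt_one (by norm_num) (by norm_num)] at this
  unfold cantorTail
  linarith

lemma cantorTail_eq {q E : ℕ → ℕ} (hq : IsBasic q) (hE : ∀ n, E n < q n) (n : ℕ) :
    cantorTail q E n = (E n + cantorTail q E (n + 1)) / q n := by
  unfold cantorTail
  rw [(cantorTail_summable hq hE n).tsum_eq_zero_add, add_div, ← tsum_div_const]
  congr 1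
  · simp
  · refine tsum_congr fun j => ?_
    rw [Finset.prod_range_succ' _ (j + 1), div_div]
    simp only [add_zero]
    have h1 : n + (j + 1) = n + 1 + j := by omega
    rw [h1]
    congr 2
    refine Finset.prod_congr rfl fun i _ => ?_
    congr 2
    omega

lemma nonpos_of_le_div {q : ℕ → ℕ} (hq : IsBasic q) {δ : ℕ → ℝ} {c : ℝ} (hc : 0 ≤ c)
    (hδ : ∀ n, δ n ≤ c) (h : ∀ n, δ n ≤ δ (n + 1) / q n) (n : ℕ) : δ n ≤ 0 := by
  have key : ∀ k n, δ n ≤ c * (1 / 2) ^ k := by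
    intro k
    induction k with
    | zero => intro n; simpa using hδ n
    | succ k ih =>
      intro n
      have h2 : (2 : ℝ) ≤ q n := by exact_mod_cast hq n
      calc δ n ≤ δ (n + 1) / q n := h n
        _ ≤ (c * (1 / 2) ^ k) / q n := by gcongr; exact ih _
        _ ≤ (c * (1 / 2) ^ k) / 2 := by gcongr
        _ = _ := by ring
  have hlim : Tendsto (fun k : ℕ => c * (1 / 2 : ℝ) ^ k) atTop (𝓝 (c * 0)) :=
    (tendsto_pow_atTop_nhds_zero_of_lt_one (by norm_num) (by norm_num)).const_mul c
  rw [mul_zero] at hlim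
  exact ge_of_tendsto' hlim fun k => key k n

lemma cantorTail_lt_one {q E : ℕ → ℕ} (hq : IsBasic q) (hE : ∀ n, E n + 2 ≤ q n) (n : ℕ) :
    cantorTail q E n < 1 := by
  have hE' : ∀ n, E n < q n := fun n => by have := hE n; omega
  have hle : ∀ n, cantorTail q E n - 1 ≤ 0 := by
    refine nonpos_of_le_div hq (c := 1) (by norm_num)
      (fun n => by linarith [cantorTail_le_two hq hE' n]) fun n => ?_
    have h2 : (0 : ℝ) < q n := by have := hq n; positivity
    have h3 : (E n : ℝ) + 2 ≤ q n := by exact_mod_cast hE n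
    rw [cantorTail_eq hq hE' n, le_div_iff₀ h2, sub_mul, div_mul_cancel₀ _ h2.ne']
    linarith
  have h2 : (0 : ℝ) < q n := by have := hq n; positivity
  have h3 : (E n : ℝ) + 2 ≤ q n := by exact_mod_cast hE n
  rw [cantorTail_eq hq hE' n, div_lt_one h2]
  linarith [hle (n + 1)]

lemma qprod_pos {q : ℕ → ℕ} (hq : ∀ n, 1 ≤ q n) (n : ℕ) : 0 < qprod q n :=
  Finset.prod_pos fun i _ => by exact_mod_cast hq i

lemma TQ_cantorTail {q E : ℕ → ℕ} (hq : IsBasic q) (hE : ∀ n, E n + 2 ≤ q n) (n : ℕ) :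
    TQ q n (cantorTail q E 0) = cantorTail q E n := by
  have hE' : ∀ n, E n < q n := fun n => by have := hE n; omega
  have key : ∃ z : ℤ, qprod q n * cantorTail q E 0 = z + cantorTail q E n := by
    induction n with
    | zero => exact ⟨0, by simp [qprod]⟩
    | succ n ih =>
      obtain ⟨z, hz⟩ := ih
      have h2 : (0 : ℝ) < q n := by have := hq n; positivity
      refine ⟨z * q n + E n, ?_⟩
      have : qprod q (n + 1) = qprod q n * q n := by simp [qprod, Finset.prod_range_succ]
      rw [this, mul_right_comm, hz, cantorTail_eq hq hE' n]
      push_cast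
      field_simp
      ring
  obtain ⟨z, hz⟩ := key
  rw [TQ, hz, Int.fract_intCast_add,
    Int.fract_eq_self.2 ⟨cantorTail_nonneg q E n, cantorTail_lt_one hq hE n⟩]

lemma qdigit_cantorTail {q E : ℕ → ℕ} (hq : IsBasic q) (hE : ∀ n, E n + 2 ≤ q n) (n : ℕ) :
    qdigit q (cantorTail q E 0) n = E n := by
  have hE' : ∀ n, E n < q n := fun n => by have := hE n; omega
  have h2 : (0 : ℝ) < q n := by have := hq n; positivity
  rw [qdigit, TQ_cantorTail hq hE, cantorTail_eq hq hE' n, mul_div_cancel₀ _ h2.ne',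
    Nat.floor_eq_iff (by have := cantorTail_nonneg q E (n + 1); positivity)]
  exact ⟨by linarith [cantorTail_nonneg q E (n + 1)],
    by linarith [cantorTail_lt_one hq hE (n + 1)]⟩

lemma abs_cantorTail_sub_le {q E E' : ℕ → ℕ} (hq : IsBasic q) (hE : ∀ n, E n < q n)
    (hE' : ∀ n, E' n < q n) (hd : ∀ n, 2 * |(E n : ℝ) - E' n| ≤ q n - 1) (n : ℕ) :
    |cantorTail q E n - cantorTail q E' n| ≤ 1 / 2 := by
  have := nonpos_of_le_div hq (δ := fun n => |cantorTail q E n - cantorTail q E' n| - 1 / 2)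
    (c := 2) (by norm_num) (fun n => by
      have h1 := cantorTail_nonneg q E n
      have h2 := cantorTail_nonneg q E' n
      have h3 := cantorTail_le_two hq hE n
      have h4 := cantorTail_le_two hq hE' n
      have : |cantorTail q E n - cantorTail q E' n| ≤ 2 := by rw [abs_le]; constructor <;> linarith
      linarith) (fun n => by
      have h2 : (0 : ℝ) < q n := by have := hq n; positivity
      have h5 := abs_add_le ((E n : ℝ) - E' n) (cantorTail q E (n + 1) - cantorTail q E' (n + 1))
      have h6 := hd n
      rw [cantorTail_eq hq hE n, cantorTail_eq hq hE' n, ← sub_div, abs_div, abs_of_pos h2,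
        le_div_iff₀ h2, sub_mul, div_mul_cancel₀ _ h2.ne', add_sub_add_comm]
      linarith) n
  simpa using this

lemma le_abs_cantorTail_sub {q E E' : ℕ → ℕ} (hq : IsBasic q) (hE : ∀ n, E n < q n)
    (hE' : ∀ n, E' n < q n) (hd : ∀ n, 2 * |(E n : ℝ) - E' n| ≤ q n - 1) {n : ℕ}
    (hlt : ∀ j < n, E j = E' j) (hne : E n ≠ E' n) :
    1 / (2 * qprod q (n + 1)) ≤ |cantorTail q E 0 - cantorTail q E' 0| := by
  have hpos : ∀ n, 0 < qprod q n := qprod_pos fun n => by have := hq n; omega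
  have hsucc : ∀ n, qprod q (n + 1) = qprod q n * q n := fun n => by
    simp [qprod, Finset.prod_range_succ]
  have hstep : ∀ n, (cantorTail q E n - cantorTail q E' n) * q n =
      ((E n : ℝ) - E' n) + (cantorTail q E (n + 1) - cantorTail q E' (n + 1)) := fun n => by
    have h2 : (0 : ℝ) < q n := by have := hq n; positivity
    rw [cantorTail_eq hq hE n, cantorTail_eq hq hE' n, ← sub_div, div_mul_cancel₀ _ h2.ne']
    ring
  have key : ∀ k ≤ n, qprod q k * (cantorTail q E 0 - cantorTail q E' 0) =
      cantorTail q E k - cantorTail q E' k := by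
    intro k
    induction k with
    | zero => simp [qprod]
    | succ k ih =>
      intro hk
      rw [hsucc, mul_right_comm, ih (by omega), hstep, hlt k (by omega)]
      ring
  have h1 : qprod q (n + 1) * (cantorTail q E 0 - cantorTail q E' 0) =
      ((E n : ℝ) - E' n) + (cantorTail q E (n + 1) - cantorTail q E' (n + 1)) := by
    rw [hsucc, mul_right_comm, key n le_rfl, hstep]
  have h2 : (1 : ℝ) ≤ |(E n : ℝ) - E' n| := by
    have : (1 : ℤ) ≤ |(E n : ℤ) - E' n| := Int.one_le_abs (by omega)
    exact_mod_cast this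
  have h3 := abs_cantorTail_sub_le hq hE hE' hd (n + 1)
  have h4 : 1 / 2 ≤ |qprod q (n + 1) * (cantorTail q E 0 - cantorTail q E' 0)| := by
    rw [h1]
    have := abs_sub_abs_le_abs_add ((E n : ℝ) - E' n)
      (cantorTail q E (n + 1) - cantorTail q E' (n + 1))
    linarith
  rw [abs_mul, abs_of_pos (hpos _)] at h4
  rw [div_le_iff₀ (by have := hpos (n + 1); positivity)]
  linarith

lemma qdigit_lt {m : ℕ → ℕ} (hm : ∀ n, 1 ≤ m n) (y : ℝ) (n : ℕ) : qdigit m y n < m n := by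
  have h : (0 : ℝ) < m n := by exact_mod_cast hm n
  rw [qdigit, Nat.floor_lt (mul_nonneg h.le (show 0 ≤ TQ m n y from Int.fract_nonneg _))]
  have h1 : TQ m n y < 1 := Int.fract_lt_one _
  nlinarith

lemma floor_qprod_succ {m : ℕ → ℕ} (y : ℝ) (n : ℕ) :
    ⌊qprod m (n + 1) * y⌋ = m n * ⌊qprod m n * y⌋ + qdigit m y n := by
  have h1 : qprod m (n + 1) * y = ((m n * ⌊qprod m n * y⌋ : ℤ) : ℝ) + m n * TQ m n y := by
    have : qprod m (n + 1) = qprod m n * m n := by simp [qprod, Finset.prod_range_succ]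
    rw [this, TQ, Int.fract]
    push_cast
    ring
  rw [h1, Int.floor_intCast_add, qdigit, Int.natCast_floor_eq_floor]
  exact mul_nonneg (by positivity) (Int.fract_nonneg _)

lemma abs_sub_le_of_qdigit_eq {m : ℕ → ℕ} (hm : ∀ n, 1 ≤ m n) {y y' : ℝ}
    (hy : y ∈ Set.Ico (0 : ℝ) 1) (hy' : y' ∈ Set.Ico (0 : ℝ) 1) {n : ℕ}
    (h : ∀ j < n, qdigit m y j = qdigit m y' j) : |y - y'| ≤ 1 / qprod m n := by
  have key : ∀ k ≤ n, ⌊qprod m k * y⌋ = ⌊qprod m k * y'⌋ := by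
    intro k
    induction k with
    | zero =>
      intro _
      simp [qprod, Int.floor_eq_zero_iff.2 hy, Int.floor_eq_zero_iff.2 hy']
    | succ k ih =>
      intro hk
      rw [floor_qprod_succ, floor_qprod_succ, ih (by omega), h k (by omega)]
  have h1 := (Int.abs_sub_lt_one_of_floor_eq_floor (key n le_rfl)).le
  have hp := qprod_pos hm n
  rw [← mul_sub, abs_mul, abs_of_pos hp] at h1
  rw [le_div_iff₀ hp]
  linarith

/-- A set of Cantor series with digits restricted to intervals of nearly full relative
logarithmic size has full Hausdorff dimension. -/
theorem one_le_dimH_digit_set {q m d : ℕ → ℕ} (hq : IsBasic q) (hm : ∀ n, 1 ≤ m n)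
    (hdm : ∀ n, d n + m n + 1 ≤ q n) (hmq : ∀ n, 2 * m n ≤ q n)
    (hgrow : ∀ s : ℝ, 0 < s → s < 1 → ∃ C : ℝ, ∀ n, qprod q (n + 1) ^ s ≤ C * qprod m n) :
    1 ≤ dimH {x : ℝ | ∀ n, d n ≤ qdigit q x n ∧ qdigit q x n < d n + m n} := by
  set e : ℝ → ℕ → ℕ := fun y n => d n + qdigit m y n with he
  set g : ℝ → ℝ := fun y => cantorTail q (e y) 0 with hg
  have heq : ∀ y n, e y n + 2 ≤ q n := fun y n => by
    have h1 := qdigit_lt hm y n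
    have h2 := hdm n
    simp only [he]
    omega
  have helt : ∀ y n, e y n < q n := fun y n => by have := heq y n; omega
  have hdiff : ∀ y y' n, 2 * |(e y n : ℝ) - e y' n| ≤ q n - 1 := by
    intro y y' n
    have h1 := qdigit_lt hm y n
    have h2 := qdigit_lt hm y' n
    have h3 := hmq n
    have h4 : 2 * |(e y n : ℤ) - e y' n| ≤ q n - 1 := by
      simp only [he]
      rcases abs_cases ((↑(d n + qdigit m y n) : ℤ) - ↑(d n + qdigit m y' n)) with h | h <;>
        push_cast at h ⊢ <;> omega
    exact_mod_cast h4
  have hqpos : ∀ n, 0 < qprod q n := qprod_pos fun n => by have := hq n; omega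
  have hsub : g '' Set.Ico 0 1 ⊆
      {x : ℝ | ∀ n, d n ≤ qdigit q x n ∧ qdigit q x n < d n + m n} := by
    rintro _ ⟨y, -, rfl⟩ n
    rw [hg, qdigit_cantorTail hq (heq y)]
    have := qdigit_lt hm y n
    simp only [he]
    omega
  refine le_trans ?_ (dimH_mono hsub)
  refine le_of_forall_lt_imp_le_of_dense fun s hs => ?_
  lift s to NNReal using (hs.trans ENNReal.one_lt_top).ne
  rcases eq_or_ne s 0 with rfl | hs0
  · simp
  have hs0' : 0 < s := pos_iff_ne_zero.2 hs0
  have hs1 : (s : ℝ) < 1 := by exact_mod_cast hs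
  obtain ⟨C, hC⟩ := hgrow s (by exact_mod_cast hs0') hs1
  have hCpos : 0 < C := by
    have h1 : 0 < C * qprod m 0 :=
      lt_of_lt_of_le (Real.rpow_pos_of_pos (hqpos 1) s) (hC 0)
    simpa [qprod] using h1
  have hexp : ∀ y ∈ Set.Ico (0 : ℝ) 1, ∀ y' ∈ Set.Ico (0 : ℝ) 1,
      |y - y'| ≤ C * 2 ^ (s : ℝ) * |g y - g y'| ^ (s : ℝ) := by
    intro y hy y' hy'
    have hM : ∀ n, 1 / qprod m n ≤ C * 2 ^ (s : ℝ) * (1 / (2 * qprod q (n + 1))) ^ (s : ℝ) := by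
      intro n
      have h2 := hqpos (n + 1)
      have h3 := Real.rpow_pos_of_pos h2 s
      rw [Real.div_rpow (by norm_num) (by positivity), Real.mul_rpow (by norm_num) h2.le,
        Real.one_rpow, div_le_iff₀ (qprod_pos hm n)]
      have h4 : (0 : ℝ) < 2 ^ (s : ℝ) := by positivity
      calc (1 : ℝ) ≤ (C * qprod m n) / qprod q (n + 1) ^ (s : ℝ) := by
            rw [le_div_iff₀ h3]; simpa using hC n
        _ = _ := by field_simp
    by_cases hall : ∀ n, qdigit m y n = qdigit m y' n
    · have hz : |y - y'| ≤ 0 := by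
        have hlim : Tendsto (fun n : ℕ => C * 2 ^ (s : ℝ) * ((1 / 2 : ℝ) ^ n) ^ (s : ℝ)) atTop
            (𝓝 (C * 2 ^ (s : ℝ) * 0 ^ (s : ℝ))) := by
          refine Tendsto.const_mul _ (Tendsto.rpow_const ?_ (Or.inr s.2))
          exact tendsto_pow_atTop_nhds_zero_of_lt_one (by norm_num) (by norm_num)
        rw [Real.zero_rpow (by exact_mod_cast hs0), mul_zero] at hlim
        refine ge_of_tendsto' hlim fun n => ?_
        refine (abs_sub_le_of_qdigit_eq hm hy hy' fun j _ => hall j).trans ((hM n).trans ?_)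
        have h5 : (2 : ℝ) ^ (n + 1) ≤ qprod q (n + 1) := by
          simpa [qprod] using two_pow_le_prod hq 0 (n + 1)
        have h6 := hqpos (n + 1)
        gcongr
        rw [one_div_pow]
        apply one_div_le_one_div_of_le (by positivity)
        rw [pow_succ] at h5
        have : (0 : ℝ) < 2 ^ n := by positivity
        linarith
      exact hz.trans (by positivity)
    · push Not at hall
      have hne := Nat.find_spec hall
      have hlt : ∀ j < Nat.find hall, qdigit m y j = qdigit m y' j := fun j hj => by
        simpa using Nat.find_min hall hj
      refine (abs_sub_le_of_qdigit_eq hm hy hy' hlt).trans ((hM _).trans ?_)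
      have h2 := hqpos (Nat.find hall + 1)
      gcongr
      refine le_abs_cantorTail_sub hq (helt y) (helt y') (hdiff y y') (fun j hj => ?_) ?_
      · simp only [he, hlt j hj]
      · simpa only [he, ne_eq, Nat.add_left_cancel_iff] using hne
  have hinj : Set.InjOn g (Set.Ico 0 1) := by
    intro y hy y' hy' h
    have := hexp y hy y' hy'
    rw [h, sub_self, abs_zero, Real.zero_rpow (by exact_mod_cast hs0), mul_zero] at this
    exact sub_eq_zero.1 (abs_nonpos_iff.1 this)
  have hinv := hinj.leftInvOn_invFunOn
  set f := Function.invFunOn g (Set.Ico 0 1) with hf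
  have hhol : HolderOnWith (Real.toNNReal (C * 2 ^ (s : ℝ))) s f (g '' Set.Ico 0 1) := by
    rintro _ ⟨y, hy, rfl⟩ _ ⟨y', hy', rfl⟩
    rw [hinv hy, hinv hy', edist_dist, edist_dist, Real.dist_eq, Real.dist_eq,
      ENNReal.ofReal_rpow_of_nonneg (abs_nonneg _) s.coe_nonneg,
      show ((C * 2 ^ (s : ℝ)).toNNReal : ENNReal) = ENNReal.ofReal (C * 2 ^ (s : ℝ)) from rfl, ← ENNReal.ofReal_mul (by positivity)]
    exact ENNReal.ofReal_le_ofReal (hexp y hy y' hy')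
  have hdim := hhol.dimH_image_le hs0'
  rw [Set.LeftInvOn.image_image hinv, Real.dimH_of_nonempty_interior (by simp)] at hdim
  rw [ENNReal.le_div_iff_mul_le (Or.inl (by exact_mod_cast hs0)) (Or.inl (by simp))] at hdim
  simpa using hdim

/-- The length of the `w`-th window of digit positions. -/
def winLen (w : ℕ) : ℕ := Nat.log 2 (w + 1) + 2

/-- The first position of the `w`-th window. -/
def winStart (w : ℕ) : ℕ := ∑ v ∈ Finset.range w, winLen v

/-- The index of the window that contains position `n`. -/
def winIdx (n : ℕ) : ℕ := Nat.findGreatest (fun w => winStart w ≤ n) n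

/-- A slowly growing basic sequence, constant on each window. -/
def winBase (n : ℕ) : ℕ := 4 * winLen (winIdx n) ^ 2

lemma winLen_mono : Monotone winLen := fun a b h => by
  have := Nat.log_mono_right (b := 2) (show a + 1 ≤ b + 1 by omega)
  simp only [winLen]
  omega

lemma two_le_winLen (w : ℕ) : 2 ≤ winLen w := by simp [winLen]

lemma tendsto_winLen : Tendsto winLen atTop atTop := by
  refine tendsto_atTop_atTop.2 fun b => ⟨2 ^ b, fun a ha => ?_⟩
  have : b ≤ Nat.log 2 (a + 1) := Nat.le_log_of_pow_le (by norm_num) (by omega)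
  simp only [winLen]
  omega

lemma winLen_le_half (w : ℕ) : winLen w ≤ winLen (w / 2) + 1 := by
  have h1 := Nat.log_div_base 2 (w + 1)
  have h2 := Nat.log_mono_right (b := 2) (show (w + 1) / 2 ≤ w / 2 + 1 by omega)
  simp only [winLen]
  omega

lemma winLen_le (w : ℕ) : winLen w ≤ w + 2 := by
  have h1 : Nat.log 2 (w + 1) < w + 1 := Nat.log_lt_of_lt_pow (by omega) Nat.lt_two_pow_self
  simp only [winLen]
  omega

lemma winStart_succ (w : ℕ) : winStart (w + 1) = winStart w + winLen w := by
  simp [winStart, Finset.sum_range_succ]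

lemma winStart_strictMono : StrictMono winStart := strictMono_nat_of_lt_succ fun w => by
  have := two_le_winLen w
  rw [winStart_succ]
  omega

lemma le_winStart (w : ℕ) : w ≤ winStart w := winStart_strictMono.le_apply

lemma winStart_winIdx_le (n : ℕ) : winStart (winIdx n) ≤ n :=
  Nat.findGreatest_spec (P := fun w => winStart w ≤ n) (Nat.zero_le n) (by simp [winStart])

lemma lt_winStart_winIdx_succ (n : ℕ) : n < winStart (winIdx n + 1) := by
  by_contra! h
  have h1 := (le_winStart _).trans h
  have := Nat.le_findGreatest (P := fun w => winStart w ≤ n) h1 h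
  simp only [winIdx] at this
  omega

lemma winIdx_mono : Monotone winIdx := fun a b h => by
  have h1 := winStart_winIdx_le a
  have h2 := lt_winStart_winIdx_succ b
  have := winStart_strictMono.lt_iff_lt.1 (lt_of_le_of_lt (h1.trans h) h2)
  omega

lemma winIdx_eq {n w : ℕ} (h1 : winStart w ≤ n) (h2 : n < winStart (w + 1)) : winIdx n = w := by
  have h3 := winStart_winIdx_le n
  have h4 := lt_winStart_winIdx_succ n
  have h5 := winStart_strictMono.lt_iff_lt.1 (lt_of_le_of_lt h1 h4)
  have h6 := winStart_strictMono.lt_iff_lt.1 (lt_of_le_of_lt h3 h2)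
  omega

lemma winIdx_winStart (w : ℕ) : winIdx (winStart w) = w :=
  winIdx_eq le_rfl (winStart_strictMono (Nat.lt_succ_self w))

lemma winIdx_le (n : ℕ) : winIdx n ≤ n := (le_winStart _).trans (winStart_winIdx_le n)

lemma tendsto_winIdx : Tendsto winIdx atTop atTop :=
  tendsto_atTop_atTop.2 fun b => ⟨winStart b, fun a ha => by
    have := winIdx_mono ha
    rwa [winIdx_winStart] at this⟩

lemma winBase_mono : Monotone winBase := fun a b h => by
  have := winLen_mono (winIdx_mono h)
  simp only [winBase]
  gcongr

lemma isBasic_winBase : IsBasic winBase := fun n => by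
  have := two_le_winLen (winIdx n)
  simp only [winBase]
  nlinarith

lemma winBase_pos (n : ℕ) : (0 : ℝ) < winBase n := by
  have := isBasic_winBase n
  positivity

lemma one_le_prod_winBase (f : ℕ → ℕ) (r : ℕ) :
    (1 : ℝ) ≤ ∏ i ∈ Finset.range r, (winBase (f i) : ℝ) := by
  have : 0 < ∏ i ∈ Finset.range r, winBase (f i) :=
    Finset.prod_pos fun i _ => by have := isBasic_winBase (f i); omega
  exact_mod_cast this

lemma winLen_le_winBase (n : ℕ) : winLen (winIdx n) ≤ winBase n := by
  have := two_le_winLen (winIdx n)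
  simp only [winBase]
  nlinarith

lemma infiniteInLimit_winBase : InfiniteInLimit winBase :=
  tendsto_atTop_mono winLen_le_winBase (tendsto_winLen.comp tendsto_winIdx)

lemma eventually_winBase_pow_le (k : ℕ) : ∀ᶠ n : ℕ in atTop, winBase (n + k) ^ k ≤ n := by
  have h1 := tendsto_pow_const_div_const_pow_of_one_lt (2 * k) (r := (2 : ℝ)) (by norm_num)
  have h2 : ∀ᶠ b : ℕ in atTop, (b : ℝ) ^ (2 * k) / 2 ^ b < 1 / (8 * 4 ^ k) :=
    h1.eventually_lt_const (by positivity)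
  have h3 : Tendsto (fun n : ℕ => winLen (n + k)) atTop atTop :=
    tendsto_winLen.comp (tendsto_add_atTop_nat k)
  filter_upwards [h3.eventually h2, eventually_ge_atTop (k + 1)] with n hn hnk
  have h4 : winBase (n + k) ≤ 4 * winLen (n + k) ^ 2 := by
    have := winLen_mono (winIdx_le (n + k))
    simp only [winBase]
    gcongr
  have h5 : 2 ^ winLen (n + k) ≤ 8 * n := by
    have : 2 ^ Nat.log 2 (n + k + 1) ≤ n + k + 1 := Nat.pow_log_le_self 2 (by omega)
    simp only [winLen, pow_add]
    omega
  refine (Nat.pow_le_pow_left h4 k).trans ?_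
  have h5' : (2 : ℝ) ^ winLen (n + k) ≤ 8 * n := by exact_mod_cast h5
  rw [div_lt_iff₀ (by positivity), one_div, inv_mul_eq_div, lt_div_iff₀ (by positivity)] at hn
  have h6 : (((4 * winLen (n + k) ^ 2) ^ k : ℕ) : ℝ) ≤ n := by
    push_cast
    rw [mul_pow, ← pow_mul]
    nlinarith
  exact_mod_cast h6

lemma Qsum_term_nonneg (q : ℕ → ℕ) (k j : ℕ) :
    0 ≤ (∏ i ∈ Finset.range k, (q (j + i) : ℝ))⁻¹ := by positivity

lemma Qsum_mono (q : ℕ → ℕ) (k : ℕ) : Monotone (Qsum q k) := fun a b h =>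
  Finset.sum_le_sum_of_subset_of_nonneg (by simpa using h) fun _ _ _ => Qsum_term_nonneg q k _

lemma Qsum_nonneg (q : ℕ → ℕ) (k n : ℕ) : 0 ≤ Qsum q k n :=
  Finset.sum_nonneg fun _ _ => Qsum_term_nonneg q k _

lemma tendsto_Qsum_winBase (k : ℕ) : Tendsto (Qsum winBase k) atTop atTop := by
  refine (not_summable_iff_tendsto_nat_atTop_of_nonneg
    (fun j => Qsum_term_nonneg winBase k j)).1 fun hsum => ?_
  refine Real.not_summable_one_div_natCast (summable_of_isBigO_nat hsum ?_)
  refine Asymptotics.IsBigO.of_bound 1 ?_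
  filter_upwards [eventually_winBase_pow_le k, eventually_ge_atTop 1] with n hn hn1
  rw [Real.norm_of_nonneg (by positivity), Real.norm_of_nonneg (Qsum_term_nonneg _ _ _), one_mul,
    one_div]
  have h1 : ∏ i ∈ Finset.range k, (winBase (n + i) : ℝ) ≤ (winBase (n + k) : ℝ) ^ k := by
    calc _ ≤ ∏ i ∈ Finset.range k, (winBase (n + k) : ℝ) :=
          Finset.prod_le_prod (fun _ _ => by positivity) fun i hi => by
            have : i < k := by simpa using hi
            exact_mod_cast winBase_mono (by omega)
      _ = _ := by simp
  have h2 : ((winBase (n + k) : ℝ)) ^ k ≤ n := by exact_mod_cast hn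
  exact inv_anti₀ (Finset.prod_pos fun i _ => winBase_pos _) (h1.trans h2)

lemma Qsum_winBase_isLittleO {k l : ℕ} (h : k < l) :
    Qsum winBase l =o[atTop] Qsum winBase k := by
  refine Asymptotics.IsLittleO.sum_range ?_ (fun j => Qsum_term_nonneg winBase k j)
    (tendsto_Qsum_winBase k)
  refine Asymptotics.isLittleO_iff.2 fun c hc => ?_
  have h1 : Tendsto (fun n => ((winBase n : ℝ))⁻¹) atTop (𝓝 0) :=
    tendsto_inv_atTop_zero.comp (tendsto_natCast_atTop_atTop.comp infiniteInLimit_winBase)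
  filter_upwards [h1.eventually_le_const hc] with n hn
  rw [Real.norm_of_nonneg (Qsum_term_nonneg _ _ _), Real.norm_of_nonneg (Qsum_term_nonneg _ _ _)]
  obtain ⟨r, rfl⟩ : ∃ r, l = k + 1 + r := ⟨l - (k + 1), by omega⟩
  rw [Finset.prod_range_add, Finset.prod_range_succ, mul_inv, mul_inv]
  have h2 : (∏ i ∈ Finset.range r, (winBase (n + (k + 1 + i)) : ℝ))⁻¹ ≤ 1 := by
    refine inv_le_one_of_one_le₀ (one_le_prod_winBase (fun i => n + (k + 1 + i)) r)
  have h3 : ((winBase (n + k) : ℝ))⁻¹ ≤ c := by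
    refine le_trans (inv_anti₀ (winBase_pos n) ?_) hn
    exact_mod_cast winBase_mono (by omega)
  have h4 : 0 ≤ (∏ i ∈ Finset.range k, (winBase (n + i) : ℝ))⁻¹ := Qsum_term_nonneg _ _ _
  have h5 : 0 ≤ ((winBase (n + k) : ℝ))⁻¹ := by positivity
  calc _ ≤ (∏ i ∈ Finset.range k, (winBase (n + i) : ℝ))⁻¹ * ((winBase (n + k) : ℝ))⁻¹ * 1 := by
        gcongr
    _ ≤ (∏ i ∈ Finset.range k, (winBase (n + i) : ℝ))⁻¹ * c * 1 := by gcongr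
    _ = _ := by ring

/-- `Q_n^{(k)}` evaluated at the start of the `w`-th window. -/
noncomputable def winSum (k w : ℕ) : ℝ := Qsum winBase k (winStart w)

lemma winSum_mono (k : ℕ) : Monotone (winSum k) := fun _ _ h =>
  Qsum_mono _ _ (winStart_strictMono.monotone h)

lemma winSum_nonneg (k w : ℕ) : 0 ≤ winSum k w := Qsum_nonneg _ _ _

lemma winSum_isLittleO {k l : ℕ} (h : k < l) : winSum l =o[atTop] winSum k :=
  (Qsum_winBase_isLittleO h).comp_tendsto winStart_strictMono.tendsto_atTop

lemma winSum_succ_le {k : ℕ} (hk : 1 ≤ k) (w : ℕ) :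
    winSum k (w + 1) ≤ winSum k w + 1 / winLen w := by
  have hl : (0 : ℝ) < winLen w := by have := two_le_winLen w; positivity
  simp only [winSum, Qsum, winStart_succ, Finset.sum_range_add]
  gcongr
  calc ∑ x ∈ Finset.range (winLen w),
        (∏ i ∈ Finset.range k, (winBase (winStart w + x + i) : ℝ))⁻¹
      ≤ ∑ x ∈ Finset.range (winLen w), 1 / (winLen w : ℝ) ^ 2 := by
        refine Finset.sum_le_sum fun x hx => ?_
        have hx' : x < winLen w := by simpa using hx
        rw [one_div]
        refine inv_anti₀ (by positivity) ?_
        obtain ⟨r, rfl⟩ : ∃ r, k = r + 1 := ⟨k - 1, by omega⟩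
        rw [Finset.prod_range_succ']
        have h1 : (1 : ℝ) ≤ ∏ i ∈ Finset.range r, (winBase (winStart w + x + (i + 1)) : ℝ) :=
          one_le_prod_winBase (fun i => winStart w + x + (i + 1)) r
        have h2 : winIdx (winStart w + x + 0) = w :=
          winIdx_eq (by omega) (by rw [winStart_succ]; omega)
        have h3 : (winLen w : ℝ) ^ 2 ≤ winBase (winStart w + x + 0) := by
          simp only [winBase, h2]
          push_cast
          nlinarith [sq_nonneg (winLen w : ℝ)]
        calc (winLen w : ℝ) ^ 2 ≤ 1 * winBase (winStart w + x + 0) := by simpa using h3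
          _ ≤ _ := by gcongr
    _ = 1 / winLen w := by
        rw [Finset.sum_const, Finset.card_range, nsmul_eq_mul]
        field_simp

lemma winSum_add_le {k : ℕ} (hk : 1 ≤ k) (w j : ℕ) :
    winSum k (w + j) ≤ winSum k w + j / winLen w := by
  induction j with
  | zero => simp
  | succ j ih =>
    have h1 := winSum_succ_le hk (w + j)
    have h2 : (1 : ℝ) / winLen (w + j) ≤ 1 / winLen w := by
      have := two_le_winLen w
      refine one_div_le_one_div_of_le (by positivity) ?_
      exact_mod_cast winLen_mono (by omega)
    rw [← add_assoc]
    push_cast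
    rw [add_div]
    linarith

lemma winSum_add_le' {k : ℕ} (hk : 1 ≤ k) (w j : ℕ) : winSum k (w + j) ≤ winSum k w + j := by
  refine (winSum_add_le hk w j).trans ?_
  have h1 : (1 : ℝ) ≤ winLen w := by
    have := two_le_winLen w
    exact_mod_cast (by omega : 1 ≤ winLen w)
  have h2 : (j : ℝ) / winLen w ≤ j := div_le_self (by positivity) h1
  linarith

lemma winSum_le {k : ℕ} (hk : 1 ≤ k) (w : ℕ) : winSum k w ≤ w := by
  have := winSum_add_le' hk 0 w
  simpa [winSum, winStart, Qsum] using this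

lemma mul_winLen_le (w : ℕ) : w * winLen w ≤ 4 * winStart w := by
  have h1 : (w - w / 2) * winLen (w / 2) ≤ winStart w := by
    calc (w - w / 2) * winLen (w / 2) = ∑ v ∈ Finset.Ico (w / 2) w, winLen (w / 2) := by simp
      _ ≤ ∑ v ∈ Finset.Ico (w / 2) w, winLen v :=
        Finset.sum_le_sum fun v hv => winLen_mono (Finset.mem_Ico.1 hv).1
      _ ≤ winStart w := Finset.sum_le_sum_of_subset fun v hv => by
        simpa using (Finset.mem_Ico.1 hv).2
  have h2 := winLen_le_half w
  have h3 := two_le_winLen (w / 2)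
  have h4 : w ≤ 2 * (w - w / 2) := by omega
  calc w * winLen w ≤ (2 * (w - w / 2)) * (2 * winLen (w / 2)) := by
        gcongr
        omega
    _ = 4 * ((w - w / 2) * winLen (w / 2)) := by ring
    _ ≤ _ := by gcongr

/-- An enumeration of all finite blocks of digits. -/
def blk (t : ℕ) : List ℕ := Denumerable.ofNat (List ℕ) t

/-- The last index `≤ W` that is congruent to `2 ^ t` modulo `2 ^ (t + 1)`. -/
def lastSlot (t W : ℕ) : ℕ := 2 ^ (t + 1) * ((W + 2 ^ t) / 2 ^ (t + 1)) - 2 ^ t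

/-- The number of copies of the block `blk t` that should have been inserted before the `W`-th
window; it only changes at windows of 2-adic valuation `t`. -/
noncomputable def quota (t W : ℕ) : ℕ := ⌊winSum (blk t).length (lastSlot t W)⌋₊

/-- The block `blk t` is inserted at the start of the `w`-th window. -/
def Inserts (S : Set ℕ) (a : ℕ → ℕ) (t w : ℕ) : Prop :=
  (blk t).length ∈ S ∧ a t ≤ w ∧ quota t w < quota t (w + 1)

/-- The number of windows before the `W`-th one at which `blk t` is inserted. -/
noncomputable def insCount (S : Set ℕ) (a : ℕ → ℕ) (t W : ℕ) : ℕ :=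
  ((Finset.range W).filter fun w => Inserts S a t w).card

lemma lastSlot_le (t W : ℕ) : lastSlot t W ≤ W := by
  have := Nat.mul_div_le (W + 2 ^ t) (2 ^ (t + 1))
  simp only [lastSlot]
  omega

lemma le_lastSlot_add (t W : ℕ) : W ≤ lastSlot t W + 2 ^ (t + 1) := by
  have := Nat.lt_mul_div_succ (W + 2 ^ t) (show 0 < 2 ^ (t + 1) by positivity)
  rw [mul_add] at this
  simp only [lastSlot]
  omega

lemma lastSlot_mono (t : ℕ) : Monotone (lastSlot t) := fun a b h =>
  Nat.sub_le_sub_right (Nat.mul_le_mul_left _ (Nat.div_le_div_right (by omega))) _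

lemma quota_mono (t : ℕ) : Monotone (quota t) := fun _ _ h =>
  Nat.floor_mono (winSum_mono _ (lastSlot_mono t h))

lemma dvd_of_quota_lt {t w : ℕ} (h : quota t w < quota t (w + 1)) :
    2 ^ (t + 1) ∣ w + 1 + 2 ^ t := by
  by_contra hn
  have h1 : (w + 1 + 2 ^ t) / 2 ^ (t + 1) = (w + 2 ^ t) / 2 ^ (t + 1) := by
    rw [add_right_comm, Nat.succ_div_of_not_dvd]
    rwa [add_right_comm]
  simp [quota, lastSlot, h1] at h

lemma dvd_succ_of_quota_lt {t w : ℕ} (h : quota t w < quota t (w + 1)) : 2 ^ t ∣ w + 1 :=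
  (Nat.dvd_add_left dvd_rfl).1 ((pow_dvd_pow 2 (Nat.le_succ t)).trans (dvd_of_quota_lt h))

lemma not_lt_of_quota_lt {t s w : ℕ} (ht : quota t w < quota t (w + 1))
    (hs : quota s w < quota s (w + 1)) : ¬ t < s := fun hts => by
  have h1 : 2 ^ (t + 1) ∣ w + 1 := (pow_dvd_pow 2 hts).trans (dvd_succ_of_quota_lt hs)
  have h2 := (Nat.dvd_add_right h1).1 (dvd_of_quota_lt ht)
  have h3 := Nat.le_of_dvd (by positivity) h2
  rw [pow_succ] at h3
  have : 0 < 2 ^ t := by positivity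
  omega

lemma Inserts.unique {S : Set ℕ} {a : ℕ → ℕ} {t s w : ℕ} (ht : Inserts S a t w)
    (hs : Inserts S a s w) : t = s := by
  have h1 := not_lt_of_quota_lt ht.2.2 hs.2.2
  have h2 := not_lt_of_quota_lt hs.2.2 ht.2.2
  omega

lemma Inserts.le {S : Set ℕ} {a : ℕ → ℕ} {t w : ℕ} (h : Inserts S a t w) : t ≤ w := by
  have h1 := Nat.le_of_dvd (by omega) (dvd_succ_of_quota_lt h.2.2)
  have h2 : t < 2 ^ t := Nat.lt_two_pow_self
  omega

lemma insCount_succ (S : Set ℕ) (a : ℕ → ℕ) (t W : ℕ) :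
    insCount S a t (W + 1) = insCount S a t W + if Inserts S a t W then 1 else 0 := by
  simp only [insCount, Finset.range_add_one, Finset.filter_insert]
  split_ifs <;> simp

lemma insCount_le_quota (S : Set ℕ) (a : ℕ → ℕ) (t W : ℕ) : insCount S a t W ≤ quota t W := by
  induction W with
  | zero => simp [insCount]
  | succ W ih =>
    have h1 := quota_mono t (Nat.le_succ W)
    rw [insCount_succ]
    split_ifs with h
    · have := h.2.2
      omega
    · exact ih.trans h1

lemma quota_le (t W : ℕ) : (quota t W : ℝ) ≤ winSum (blk t).length W :=
  (Nat.floor_le (winSum_nonneg _ _)).trans (winSum_mono _ (lastSlot_le t W))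

lemma insCount_le_winSum (S : Set ℕ) (a : ℕ → ℕ) (t W : ℕ) :
    (insCount S a t W : ℝ) ≤ winSum (blk t).length W :=
  le_trans (by exact_mod_cast insCount_le_quota S a t W) (quota_le t W)

lemma insCount_eq_zero {S : Set ℕ} {a : ℕ → ℕ} {t W : ℕ}
    (h : (blk t).length ∉ S ∨ W ≤ a t ∨ W ≤ t) : insCount S a t W = 0 := by
  refine Finset.card_eq_zero.2 (Finset.filter_eq_empty_iff.2 fun w hw hi => ?_)
  have hw' : w < W := by simpa using hw
  rcases h with h | h | h
  · exact h hi.1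
  · have := hi.2.1
    omega
  · have := hi.le
    omega

/-- Conditions on the index `W` under which the block `blk t` may be inserted. -/
structure GateAt (t W : ℕ) : Prop where
  length_lt : (blk t).length < winLen W
  digit_lt : ∀ d ∈ blk t, d < winLen W
  quota_succ : quota t (W + 1) ≤ quota t W + 1
  length_mul_le : ∀ k < (blk t).length,
    (blk t).length * winSum (blk t).length W ≤ (1 / 2) ^ t * winSum k W
  log_mul_le : (blk t).length * (W * Real.log (winLen W)) ≤ (1 / 2) ^ t * winStart W

lemma mul_log_isLittleO :
    (fun W : ℕ => (W : ℝ) * Real.log (winLen W)) =o[atTop] fun W : ℕ => (winStart W : ℝ) := by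
  have h1 : (fun W : ℕ => Real.log (winLen W)) =o[atTop] fun W : ℕ => (winLen W : ℝ) :=
    Real.isLittleO_log_id_atTop.comp_tendsto (tendsto_natCast_atTop_atTop.comp tendsto_winLen)
  have h2 := (Asymptotics.isBigO_refl (fun W : ℕ => (W : ℝ)) atTop).mul_isLittleO h1
  refine h2.trans_isBigO (Asymptotics.IsBigO.of_bound 4 (Eventually.of_forall fun W => ?_))
  rw [Real.norm_of_nonneg (by positivity), Real.norm_of_nonneg (by positivity)]
  exact_mod_cast mul_winLen_le W

lemma eventually_gateAt {t : ℕ} (ht : 1 ≤ (blk t).length) : ∀ᶠ W in atTop, GateAt t W := by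
  have h1 : ∀ᶠ W in atTop, (blk t).length < winLen W := tendsto_winLen.eventually_gt_atTop _
  have h2 : ∀ᶠ W in atTop, ∀ d ∈ blk t, d < winLen W := by
    filter_upwards [tendsto_winLen.eventually_gt_atTop (blk t).sum] with W hW d hd
    exact (List.le_sum_of_mem hd).trans_lt hW
  have h3 : ∀ᶠ W in atTop, quota t (W + 1) ≤ quota t W + 1 := by
    have hlim : Tendsto (fun W => winLen (lastSlot t W)) atTop atTop :=
      tendsto_winLen.comp (tendsto_atTop_mono (fun W => by
        have := le_lastSlot_add t W
        omega) (tendsto_sub_atTop_nat (2 ^ (t + 1))))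
    filter_upwards [hlim.eventually_ge_atTop (2 ^ (t + 1) + 1)] with W hW
    have h4 : lastSlot t (W + 1) ≤ lastSlot t W + (2 ^ (t + 1) + 1) :=
      (lastSlot_le t (W + 1)).trans (by have := le_lastSlot_add t W; omega)
    have h5 := winSum_add_le ht (lastSlot t W) (2 ^ (t + 1) + 1)
    have h6 : ((2 ^ (t + 1) + 1 : ℕ) : ℝ) / winLen (lastSlot t W) ≤ 1 :=
      div_le_one_of_le₀ (by exact_mod_cast hW) (by positivity)
    have h7 := winSum_mono (blk t).length h4
    simp only [quota]
    rw [← Nat.floor_add_one (winSum_nonneg _ _)]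
    exact Nat.floor_mono (by linarith)
  have h4 : ∀ᶠ W in atTop, ∀ k < (blk t).length,
      (blk t).length * winSum (blk t).length W ≤ (1 / 2) ^ t * winSum k W := by
    refine (Set.finite_lt_nat (blk t).length).eventually_all.2 fun k hk => ?_
    have hc : (0 : ℝ) < (1 / 2) ^ t / (blk t).length := by positivity
    filter_upwards [(winSum_isLittleO hk).bound hc] with W hW
    rw [Real.norm_of_nonneg (winSum_nonneg _ _), Real.norm_of_nonneg (winSum_nonneg _ _),
      div_mul_eq_mul_div, le_div_iff₀ (by positivity)] at hW
    linarith
  have h5 : ∀ᶠ W : ℕ in atTop,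
      (blk t).length * (W * Real.log (winLen W)) ≤ (1 / 2) ^ t * winStart W := by
    have hc : (0 : ℝ) < (1 / 2) ^ t / (blk t).length := by positivity
    filter_upwards [mul_log_isLittleO.bound hc] with W hW
    rw [Real.norm_of_nonneg (by positivity), Real.norm_of_nonneg (by positivity),
      div_mul_eq_mul_div, le_div_iff₀ (by positivity)] at hW
    linarith
  filter_upwards [h1, h2, h3, h4, h5] with W a b c d e
  exact ⟨a, b, c, d, e⟩

lemma exists_gate : ∃ a : ℕ → ℕ, ∀ t, 1 ≤ (blk t).length → ∀ W, a t ≤ W → GateAt t W := by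
  have : ∀ t, ∃ a : ℕ, 1 ≤ (blk t).length → ∀ W, a ≤ W → GateAt t W := fun t => by
    by_cases ht : 1 ≤ (blk t).length
    · obtain ⟨a, ha⟩ := eventually_atTop.1 (eventually_gateAt ht)
      exact ⟨a, fun _ => ha⟩
    · exact ⟨0, fun h => absurd h ht⟩
  choose a ha using this
  exact ⟨a, ha⟩

/-- `a` is a valid choice of thresholds from which on blocks are inserted. -/
def IsGate (S : Set ℕ) (a : ℕ → ℕ) : Prop :=
  ∀ t, (blk t).length ∈ S → 1 ≤ (blk t).length ∧ ∀ W, a t ≤ W → GateAt t W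

lemma insCount_add_quota {S : Set ℕ} {a : ℕ → ℕ} (ha : IsGate S a) {t : ℕ}
    (ht : (blk t).length ∈ S) {W : ℕ} (hW : a t ≤ W) :
    insCount S a t W + quota t (a t) = quota t W := by
  induction W, hW using Nat.le_induction with
  | base => rw [insCount_eq_zero (Or.inr (Or.inl le_rfl)), zero_add]
  | succ W hW ih =>
    have h1 := ((ha t ht).2 W hW).quota_succ
    have h2 := quota_mono t (Nat.le_succ W)
    rw [insCount_succ]
    split_ifs with h
    · have := h.2.2
      omega
    · have : ¬ quota t W < quota t (W + 1) := fun h' => h ⟨ht, hW, h'⟩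
      simp only [Nat.succ_eq_add_one] at h2
      omega

lemma winSum_le_insCount_add {S : Set ℕ} {a : ℕ → ℕ} (ha : IsGate S a) {t : ℕ}
    (ht : (blk t).length ∈ S) : ∃ C : ℝ, ∀ᶠ W in atTop,
      winSum (blk t).length W ≤ insCount S a t W + C := by
  refine ⟨quota t (a t) + 1 + 2 ^ (t + 1), ?_⟩
  filter_upwards [eventually_ge_atTop (a t)] with W hW
  have h1 : (insCount S a t W : ℝ) + quota t (a t) = quota t W := by
    exact_mod_cast insCount_add_quota ha ht hW
  have h2 := winSum_mono (blk t).length (le_lastSlot_add t W)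
  have h3 := winSum_add_le' (ha t ht).1 (lastSlot t W) (2 ^ (t + 1))
  have h4 := Nat.lt_floor_add_one (winSum (blk t).length (lastSlot t W))
  simp only [quota] at h1 ⊢
  push_cast at h3
  linarith

/-- The total length of the blocks of length `> k` inserted before the `W`-th window. -/
noncomputable def mass (S : Set ℕ) (a : ℕ → ℕ) (k W : ℕ) : ℕ :=
  ∑ t ∈ (Finset.range W).filter fun t => k < (blk t).length, (blk t).length * insCount S a t W

lemma tendsto_mass_mul_div {S : Set ℕ} {a : ℕ → ℕ} {k : ℕ} {g v : ℕ → ℝ}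
    (hg : ∀ W, 0 ≤ g W) (hv : ∀ W, 0 ≤ v W)
    (hdom : ∀ t, (blk t).length ∈ S → k < (blk t).length → ∀ W, a t ≤ W →
      (blk t).length * (insCount S a t W * g W) ≤ (1 / 2) ^ t * v W)
    (hlim : ∀ t, k < (blk t).length →
      Tendsto (fun W => (insCount S a t W * g W) / v W) atTop (𝓝 0)) :
    Tendsto (fun W => (mass S a k W * g W) / v W) atTop (𝓝 0) := by
  set f : ℕ → ℕ → ℝ := fun W t => if k < (blk t).length then
    (blk t).length * ((insCount S a t W * g W) / v W) else 0 with hf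
  have hsum : ∀ W, (mass S a k W * g W) / v W = ∑' t, f W t := by
    intro W
    rw [tsum_eq_sum (s := Finset.range W)]
    · simp only [hf, mass, Finset.sum_filter]
      push_cast
      rw [Finset.sum_mul, Finset.sum_div]
      refine Finset.sum_congr rfl fun t _ => ?_
      split_ifs
      · ring
      · simp
    · intro t ht
      have : W ≤ t := by simpa using ht
      simp [hf, insCount_eq_zero (S := S) (a := a) (Or.inr (Or.inr this))]
  simp only [hsum]
  have h0 : Tendsto (fun W => ∑' t, f W t) atTop (𝓝 (∑' _ : ℕ, (0 : ℝ))) := by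
    refine tendsto_tsum_of_dominated_convergence (bound := fun t : ℕ => (1 / 2 : ℝ) ^ t)
      (summable_geometric_of_lt_one (by norm_num) (by norm_num)) (fun t => ?_)
      (Eventually.of_forall fun W t => ?_)
    · by_cases ht : k < (blk t).length
      · simpa [hf, ht] using (hlim t ht).const_mul ((blk t).length : ℝ)
      · simp [hf, ht]
    · simp only [hf]
      split_ifs with ht
      · have hnn : 0 ≤ (insCount S a t W * g W) / v W :=
          div_nonneg (mul_nonneg (by positivity) (hg W)) (hv W)
        rw [Real.norm_of_nonneg (by positivity), ← mul_div_assoc]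
        by_cases h : (blk t).length ∈ S ∧ a t ≤ W
        · exact div_le_of_le_mul₀ (hv W) (by positivity) (hdom t h.1 ht W h.2)
        · have h0 : insCount S a t W = 0 := insCount_eq_zero (by
            rcases not_and_or.1 h with h | h
            · exact Or.inl h
            · exact Or.inr (Or.inl (by omega)))
          simp [h0]
      · simp
  simpa using h0

lemma tendsto_mass_div_winSum {S : Set ℕ} {a : ℕ → ℕ} (ha : IsGate S a) (k : ℕ) :
    Tendsto (fun W => (mass S a k W : ℝ) / winSum k W) atTop (𝓝 0) := by
  have := tendsto_mass_mul_div (S := S) (a := a) (k := k) (g := fun _ => 1) (v := winSum k)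
    (fun _ => zero_le_one) (winSum_nonneg k) (fun t ht hk W hW => by
      refine le_trans ?_ (((ha t ht).2 W hW).length_mul_le k hk)
      rw [mul_one]
      gcongr
      exact insCount_le_winSum S a t W) (fun t ht => by
      refine squeeze_zero (fun W => div_nonneg (by positivity) (winSum_nonneg _ _)) (fun W => ?_)
        (winSum_isLittleO ht).tendsto_div_nhds_zero
      rw [mul_one]
      have := winSum_nonneg k W
      gcongr
      exact insCount_le_winSum S a t W)
  simpa using this

lemma tendsto_mass_mul_log {S : Set ℕ} {a : ℕ → ℕ} (ha : IsGate S a) :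
    Tendsto (fun W => (mass S a 0 W * Real.log (winLen W)) / winStart W) atTop (𝓝 0) := by
  have hle : ∀ t W, 0 < (blk t).length → (insCount S a t W : ℝ) ≤ W := fun t W ht =>
    (insCount_le_winSum S a t W).trans (winSum_le ht W)
  refine tendsto_mass_mul_div (fun _ => by positivity) (fun _ => by positivity)
    (fun t ht hk W hW => ?_) fun t ht => ?_
  · refine le_trans ?_ ((ha t ht).2 W hW).log_mul_le
    gcongr
    exact_mod_cast hle t W hk
  · refine squeeze_zero (fun W => by positivity) (fun W => ?_)
      mul_log_isLittleO.tendsto_div_nhds_zero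
    gcongr
    exact_mod_cast hle t W ht

/-- Position `n` lies in an inserted block of length `> k`. -/
def Covered (S : Set ℕ) (a : ℕ → ℕ) (k n : ℕ) : Prop :=
  ∃ t, k < (blk t).length ∧ Inserts S a t (winIdx n) ∧
    n < winStart (winIdx n) + (blk t).length

/-- The smallest admissible digit at position `n`: the digit of the inserted block covering `n`,
or a large digit outside of the inserted blocks. -/
noncomputable def insDigit (S : Set ℕ) (a : ℕ → ℕ) (n : ℕ) : ℕ :=
  if h : Covered S a 0 n then (blk h.choose).getD (n - winStart (winIdx n)) 0
  else winLen (winIdx n)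

/-- The number of admissible digits at position `n`. -/
noncomputable def insChoices (S : Set ℕ) (a : ℕ → ℕ) (n : ℕ) : ℕ :=
  if Covered S a 0 n then 1 else winLen (winIdx n) ^ 2

/-- The reals all of whose digits in base `winBase` are admissible. -/
def insSet (S : Set ℕ) (a : ℕ → ℕ) : Set ℝ :=
  {x | ∀ n, insDigit S a n ≤ qdigit winBase x n ∧
    qdigit winBase x n < insDigit S a n + insChoices S a n}

lemma card_covered_le (S : Set ℕ) (a : ℕ → ℕ) (k n : ℕ) :
    ((Finset.range n).filter fun j => Covered S a k j).card ≤ mass S a k (winIdx n + 1) := by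
  set W := winIdx n + 1 with hW
  have hsub : ((Finset.range n).filter fun j => Covered S a k j) ⊆
      ((Finset.range W).filter fun t => k < (blk t).length).biUnion fun t =>
        ((Finset.range W).filter fun w => Inserts S a t w).biUnion fun w =>
          Finset.Ico (winStart w) (winStart w + (blk t).length) := by
    intro j hj
    obtain ⟨hj, t, hk, hi, hlt⟩ := Finset.mem_filter.1 hj
    have h1 : winIdx j ≤ winIdx n := winIdx_mono (Finset.mem_range.1 hj).le
    have h2 := hi.le
    refine Finset.mem_biUnion.2 ⟨t, by simp; omega, Finset.mem_biUnion.2 ⟨winIdx j, ?_, ?_⟩⟩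
    · simp only [Finset.mem_filter, Finset.mem_range]
      exact ⟨by omega, hi⟩
    · exact Finset.mem_Ico.2 ⟨winStart_winIdx_le j, hlt⟩
  refine (Finset.card_le_card hsub).trans (Finset.card_biUnion_le.trans ?_)
  refine Finset.sum_le_sum fun t _ => Finset.card_biUnion_le.trans ?_
  simp [insCount, mul_comm]

lemma Covered.insDigit_eq {S : Set ℕ} {a : ℕ → ℕ} {t n : ℕ} (h : Inserts S a t (winIdx n))
    (hn : n < winStart (winIdx n) + (blk t).length) :
    Covered S a 0 n ∧ insDigit S a n = (blk t).getD (n - winStart (winIdx n)) 0 := by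
  have hc : Covered S a 0 n := ⟨t, by have := winStart_winIdx_le n; omega, h, hn⟩
  refine ⟨hc, ?_⟩
  rw [insDigit, dif_pos hc, hc.choose_spec.2.1.unique h]

lemma qdigit_of_inserts {S : Set ℕ} {a : ℕ → ℕ} {x : ℝ} (hx : x ∈ insSet S a) {t n : ℕ}
    (h : Inserts S a t (winIdx n)) (hn : n < winStart (winIdx n) + (blk t).length) :
    qdigit winBase x n = (blk t).getD (n - winStart (winIdx n)) 0 := by
  obtain ⟨h1, h2⟩ := Covered.insDigit_eq h hn
  have h3 := hx n
  rw [insChoices, if_pos h1, h2] at h3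
  omega

lemma winLen_le_qdigit {S : Set ℕ} {a : ℕ → ℕ} {x : ℝ} (hx : x ∈ insSet S a) {n : ℕ}
    (h : ¬ Covered S a 0 n) : winLen (winIdx n) ≤ qdigit winBase x n := by
  have h3 := (hx n).1
  rwa [insDigit, dif_neg h] at h3

lemma insDigit_lt {S : Set ℕ} {a : ℕ → ℕ} (ha : IsGate S a) {n : ℕ} (h : Covered S a 0 n) :
    insDigit S a n < winLen (winIdx n) := by
  obtain ⟨t, -, hi, hn⟩ := h
  rw [(Covered.insDigit_eq hi hn).2]
  have h1 := winStart_winIdx_le n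
  have h2 : n - winStart (winIdx n) < (blk t).length := by omega
  rw [List.getD_eq_getElem _ _ h2]
  exact ((ha t hi.1).2 _ hi.2.1).digit_lt _ (List.getElem_mem h2)

/-- The index of a given block in the enumeration `blk`. -/
def blkIdx {k : ℕ} (B : Fin k → ℕ) : ℕ := Encodable.encode (List.ofFn B)

lemma blk_blkIdx {k : ℕ} (B : Fin k → ℕ) : blk (blkIdx B) = List.ofFn B := by
  simp [blk, blkIdx]

lemma blk_injective : Function.Injective blk := fun t s h => by
  have := congrArg Encodable.encode h
  simpa [blk] using this

lemma insCount_le_blockCount {S : Set ℕ} {a : ℕ → ℕ} (ha : IsGate S a) {x : ℝ}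
    (hx : x ∈ insSet S a) {k : ℕ} (B : Fin k → ℕ) (n : ℕ) :
    insCount S a (blkIdx B) (winIdx n) ≤ blockCount winBase x B n := by
  rw [insCount, ← Finset.card_image_of_injective _ winStart_strictMono.injective]
  refine Finset.card_le_card fun i hi => ?_
  obtain ⟨w, hw, rfl⟩ := Finset.mem_image.1 hi
  obtain ⟨hwn, hins⟩ := Finset.mem_filter.1 hw
  have hlen : (blk (blkIdx B)).length = k := by simp [blk_blkIdx]
  have hlt := ((ha _ hins.1).2 w hins.2.1).length_lt
  refine Finset.mem_filter.2 ⟨?_, fun j => ?_⟩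
  · exact Finset.mem_range.2 ((winStart_strictMono (by simpa using hwn)).trans_le
      (winStart_winIdx_le n))
  · have hw' : winIdx (winStart w + j) = w :=
      winIdx_eq (by omega) (by rw [winStart_succ]; omega)
    rw [qdigit_of_inserts hx (t := blkIdx B) (by rwa [hw']) (by rw [hw', hlen]; omega), hw',
      Nat.add_sub_cancel_left, blk_blkIdx, List.getD_eq_getElem _ _ (by simp)]
    simp

lemma occurrence_cases {S : Set ℕ} {a : ℕ → ℕ} (ha : IsGate S a) {x : ℝ} (hx : x ∈ insSet S a)
    {k : ℕ} (hk : 1 ≤ k) {B : Fin k → ℕ} {i : ℕ} (hB : ∀ j, B j < winLen (winIdx i))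
    (hi : ∀ j : Fin k, qdigit winBase x (i + j) = B j) :
    Covered S a k i ∨ (winStart (winIdx i) = i ∧ Inserts S a (blkIdx B) (winIdx i)) := by
  have hcov : ∀ j < k, Covered S a 0 (i + j) := fun j hj => by
    by_contra hc
    have h1 := winLen_le_qdigit hx hc
    have h2 := hi ⟨j, hj⟩
    have h3 := hB ⟨j, hj⟩
    have h4 := winLen_mono (winIdx_mono (show i ≤ i + j by omega))
    simp only at h2
    omega
  obtain ⟨t, ht0, hins, hlt⟩ := hcov 0 hk
  rw [add_zero] at hins hlt
  have hlen := ((ha _ hins.1).2 _ hins.2.1).length_lt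
  have hstart := winStart_winIdx_le i
  have hwin : ∀ j < k, winIdx (i + j) = winIdx i ∧
      i + j < winStart (winIdx i) + (blk t).length := by
    intro j
    induction j with
    | zero => exact fun _ => ⟨rfl, hlt⟩
    | succ j ih =>
      intro hj
      have h1 := (ih (by omega)).2
      have h2 : winIdx (i + (j + 1)) = winIdx i :=
        winIdx_eq (by omega) (by rw [winStart_succ]; omega)
      obtain ⟨s, -, hs, hlt'⟩ := hcov (j + 1) hj
      rw [h2] at hs hlt'
      rw [hs.unique hins] at hlt'
      exact ⟨h2, hlt'⟩
  have hlast := (hwin (k - 1) (by omega)).2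
  rcases lt_or_ge k (blk t).length with hkt | hkt
  · exact Or.inl ⟨t, hkt, hins, hlt⟩
  · have hkeq : (blk t).length = k := by omega
    have hieq : winStart (winIdx i) = i := by omega
    refine Or.inr ⟨hieq, ?_⟩
    have : t = blkIdx B := blk_injective <| by
      rw [blk_blkIdx]
      refine List.ext_getElem (by simp [hkeq]) fun j hj hj' => ?_
      have hjk : j < k := by omega
      obtain ⟨h1, h2⟩ := hwin j hjk
      have h3 := qdigit_of_inserts hx (t := t) (n := i + j) (by rwa [h1]) (by rwa [h1])
      rw [h1, hieq, Nat.add_sub_cancel_left, List.getD_eq_getElem _ _ hj] at h3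
      rw [← h3, List.getElem_ofFn]
      exact hi ⟨j, hjk⟩
    rwa [← this]

lemma exists_blockCount_le {S : Set ℕ} {a : ℕ → ℕ} (ha : IsGate S a) {x : ℝ}
    (hx : x ∈ insSet S a) {k : ℕ} (hk : 1 ≤ k) (B : Fin k → ℕ) :
    ∃ N : ℕ, ∀ n, blockCount winBase x B n ≤
      N + mass S a k (winIdx n + 1) + insCount S a (blkIdx B) (winIdx n + 1) := by
  have hev : ∀ᶠ i in atTop, ∀ j, B j < winLen (winIdx i) :=
    eventually_all.2 fun j => (tendsto_winLen.comp tendsto_winIdx).eventually_gt_atTop (B j)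
  obtain ⟨N, hN⟩ := eventually_atTop.1 hev
  refine ⟨N, fun n => ?_⟩
  have hsub : ((Finset.range n).filter fun i => ∀ j : Fin k, qdigit winBase x (i + (j : ℕ)) = B j) ⊆
      (Finset.range N ∪ (Finset.range n).filter fun j => Covered S a k j) ∪
        (((Finset.range (winIdx n + 1)).filter fun w => Inserts S a (blkIdx B) w).image
          winStart) := by
    intro i hi
    obtain ⟨hin, hocc⟩ := Finset.mem_filter.1 hi
    rcases lt_or_ge i N with h | h
    · exact Finset.mem_union_left _ (Finset.mem_union_left _ (Finset.mem_range.2 h))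
    rcases occurrence_cases ha hx hk (hN i h) hocc with hc | ⟨h1, h2⟩
    · exact Finset.mem_union_left _ (Finset.mem_union_right _ (Finset.mem_filter.2 ⟨hin, hc⟩))
    · refine Finset.mem_union_right _ (Finset.mem_image.2 ⟨winIdx i, ?_, h1⟩)
      have : winIdx i ≤ winIdx n := winIdx_mono (Finset.mem_range.1 hin).le
      exact Finset.mem_filter.2 ⟨Finset.mem_range.2 (by omega), h2⟩
  refine (Finset.card_le_card hsub).trans ((Finset.card_union_le _ _).trans ?_)
  refine add_le_add ((Finset.card_union_le _ _).trans (add_le_add (by simp) ?_))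
    Finset.card_image_le
  exact card_covered_le S a k n

lemma winSum_winIdx_le (k n : ℕ) : winSum k (winIdx n) ≤ Qsum winBase k n :=
  Qsum_mono _ _ (winStart_winIdx_le n)

lemma Qsum_le_winSum (k n : ℕ) : Qsum winBase k n ≤ winSum k (winIdx n + 1) :=
  Qsum_mono _ _ (lt_winStart_winIdx_succ n).le

lemma winSum_winIdx_succ_le {k : ℕ} (hk : 1 ≤ k) (n : ℕ) :
    winSum k (winIdx n + 1) ≤ Qsum winBase k n + 1 := by
  have h1 := winSum_add_le' hk (winIdx n) 1
  have h2 := winSum_winIdx_le k n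
  push_cast at h1
  linarith

lemma tendsto_mass_div_Qsum {S : Set ℕ} {a : ℕ → ℕ} (ha : IsGate S a) {k : ℕ} (hk : 1 ≤ k)
    (N : ℝ) :
    Tendsto (fun n => (N + mass S a k (winIdx n + 1)) / Qsum winBase k n) atTop (𝓝 0) := by
  have hQ := tendsto_Qsum_winBase k
  have h1 : Tendsto (fun n => (mass S a k (winIdx n + 1) : ℝ) / winSum k (winIdx n + 1)) atTop
      (𝓝 0) := (tendsto_mass_div_winSum ha k).comp
        ((tendsto_add_atTop_nat 1).comp tendsto_winIdx)
  have h2 : Tendsto (fun n => N / Qsum winBase k n +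
      (mass S a k (winIdx n + 1) : ℝ) / winSum k (winIdx n + 1) * 2) atTop (𝓝 (0 + 0 * 2)) :=
    (hQ.const_div_atTop N).add (h1.mul_const 2)
  rw [zero_mul, add_zero] at h2
  refine tendsto_of_tendsto_of_tendsto_of_le_of_le' (hQ.const_div_atTop N) h2 ?_ ?_
  · filter_upwards with n
    have := Qsum_nonneg winBase k n
    gcongr
    simp
  · filter_upwards [hQ.eventually_ge_atTop 1] with n hn
    have h3 := winSum_winIdx_succ_le hk n
    have h4 := Qsum_le_winSum k n
    have h5 : (0 : ℝ) ≤ mass S a k (winIdx n + 1) := by positivity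
    have h6 : (mass S a k (winIdx n + 1) : ℝ) / Qsum winBase k n ≤
        mass S a k (winIdx n + 1) * 2 / winSum k (winIdx n + 1) := by
      rw [div_le_div_iff₀ (by linarith) (by linarith)]
      nlinarith
    rw [add_div, div_mul_eq_mul_div]
    linarith

lemma tendsto_blockCount_of_notMem {S : Set ℕ} {a : ℕ → ℕ} (ha : IsGate S a) {x : ℝ}
    (hx : x ∈ insSet S a) {k : ℕ} (hk : 1 ≤ k) (hkS : k ∉ S) (B : Fin k → ℕ) :
    Tendsto (fun n => (blockCount winBase x B n : ℝ) / Qsum winBase k n) atTop (𝓝 0) := by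
  obtain ⟨N, hN⟩ := exists_blockCount_le ha hx hk B
  refine squeeze_zero (fun n => div_nonneg (by positivity) (Qsum_nonneg _ _ _)) (fun n => ?_)
    (tendsto_mass_div_Qsum ha hk N)
  have h1 := hN n
  rw [insCount_eq_zero (Or.inl (by simpa [blk_blkIdx] using hkS))] at h1
  have := Qsum_nonneg winBase k n
  gcongr
  exact_mod_cast h1

lemma tendsto_blockCount_of_mem {S : Set ℕ} {a : ℕ → ℕ} (ha : IsGate S a) {x : ℝ}
    (hx : x ∈ insSet S a) {k : ℕ} (hk : 1 ≤ k) (hkS : k ∈ S) (B : Fin k → ℕ) :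
    Tendsto (fun n => (blockCount winBase x B n : ℝ) / Qsum winBase k n) atTop (𝓝 1) := by
  obtain ⟨N, hN⟩ := exists_blockCount_le ha hx hk B
  have hlen : (blk (blkIdx B)).length = k := by simp [blk_blkIdx]
  obtain ⟨C, hC⟩ := winSum_le_insCount_add ha (t := blkIdx B) (by rwa [hlen])
  rw [hlen] at hC
  have hQ := tendsto_Qsum_winBase k
  have hlow : Tendsto (fun n => 1 - (C + 1) / Qsum winBase k n) atTop (𝓝 (1 - 0)) :=
    (hQ.const_div_atTop (C + 1)).const_sub 1
  have hupp : Tendsto (fun n => 1 + ((N + 1 : ℝ) + mass S a k (winIdx n + 1)) / Qsum winBase k n)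
      atTop (𝓝 (1 + 0)) := (tendsto_mass_div_Qsum ha hk (N + 1)).const_add 1
  rw [sub_zero] at hlow
  rw [add_zero] at hupp
  refine tendsto_of_tendsto_of_tendsto_of_le_of_le' hlow hupp ?_ ?_
  · filter_upwards [tendsto_winIdx.eventually hC, hQ.eventually_gt_atTop 0] with n hn hpos
    have h1 : (insCount S a (blkIdx B) (winIdx n) : ℝ) ≤ blockCount winBase x B n := by
      exact_mod_cast insCount_le_blockCount ha hx B n
    have h2 := winSum_add_le' hk (winIdx n) 1
    have h3 := Qsum_le_winSum k n
    rw [one_sub_div hpos.ne']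
    push_cast at h2
    gcongr
    linarith
  · filter_upwards [hQ.eventually_gt_atTop 0] with n hpos
    have h1 : (blockCount winBase x B n : ℝ) ≤
        N + mass S a k (winIdx n + 1) + insCount S a (blkIdx B) (winIdx n + 1) := by
      exact_mod_cast hN n
    have h2 := insCount_le_winSum S a (blkIdx B) (winIdx n + 1)
    rw [hlen] at h2
    have h3 := winSum_winIdx_succ_le hk n
    rw [one_add_div hpos.ne']
    gcongr
    linarith

/-- The logarithm of the length of the window containing `n`. -/
noncomputable def logLen (n : ℕ) : ℝ := Real.log (winLen (winIdx n))

lemma logLen_nonneg (n : ℕ) : 0 ≤ logLen n := by unfold logLen; positivity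

lemma logLen_le (n : ℕ) : logLen n ≤ n + 1 := by
  have h1 := two_le_winLen (winIdx n)
  have h2 := Real.log_le_sub_one_of_pos (show (0 : ℝ) < winLen (winIdx n) by positivity)
  have h3 : (winLen (winIdx n) : ℝ) ≤ winIdx n + 2 := by exact_mod_cast winLen_le (winIdx n)
  have h4 : (winIdx n : ℝ) ≤ n := by exact_mod_cast winIdx_le n
  unfold logLen
  linarith

lemma eventually_le_sum_logLen {A : ℝ} (hA : 0 < A) :
    ∀ᶠ n : ℕ in atTop, A * n ≤ ∑ j ∈ Finset.range n, logLen j := by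
  have hlim : Tendsto logLen atTop atTop :=
    Real.tendsto_log_atTop.comp (tendsto_natCast_atTop_atTop.comp
      (tendsto_winLen.comp tendsto_winIdx))
  have h1 : (fun _ : ℕ => (1 : ℝ)) =o[atTop] logLen :=
    Asymptotics.isLittleO_const_left.2 (Or.inr (tendsto_norm_atTop_atTop.comp hlim))
  have h2 : Tendsto (fun n => ∑ j ∈ Finset.range n, logLen j) atTop atTop := by
    have hpos : 0 < Real.log 2 := Real.log_pos (by norm_num)
    refine tendsto_atTop_mono (fun n => ?_)
      (tendsto_natCast_atTop_atTop.atTop_mul_const hpos)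
    calc (n : ℝ) * Real.log 2 = ∑ j ∈ Finset.range n, Real.log 2 := by simp
      _ ≤ _ := Finset.sum_le_sum fun j _ => Real.log_le_log (by norm_num)
        (by exact_mod_cast two_le_winLen (winIdx j))
  have h3 := h1.sum_range logLen_nonneg h2
  filter_upwards [h3.bound (inv_pos.2 hA)] with n hn
  rw [Real.norm_of_nonneg (by simp),
    Real.norm_of_nonneg (Finset.sum_nonneg fun j _ => logLen_nonneg j)] at hn
  rw [inv_mul_eq_div, le_div_iff₀ hA] at hn
  simp only [Finset.sum_const, Finset.card_range, nsmul_eq_mul, mul_one] at hn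
  linarith

lemma eventually_sum_covered_le {S : Set ℕ} {a : ℕ → ℕ} (ha : IsGate S a) :
    ∀ᶠ n : ℕ in atTop,
      ∑ j ∈ (Finset.range n).filter (fun j => Covered S a 0 j), logLen j ≤ n := by
  have h1 : Tendsto (fun n => winIdx n + 1) atTop atTop :=
    (tendsto_add_atTop_nat 1).comp tendsto_winIdx
  filter_upwards [h1.eventually ((tendsto_mass_mul_log ha).eventually_lt_const
    (show (0 : ℝ) < 1 / 4 by norm_num)), eventually_ge_atTop 1] with n hn hn1
  have h2 : 0 < winStart (winIdx n + 1) := lt_of_le_of_lt (Nat.zero_le n)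
    (lt_winStart_winIdx_succ n)
  have h3 : winStart (winIdx n + 1) ≤ 4 * n := by
    have e1 := winStart_winIdx_le n
    have e2 := winLen_le (winIdx n)
    have e3 := winIdx_le n
    rw [winStart_succ]
    omega
  have h3' : (winStart (winIdx n + 1) : ℝ) ≤ 4 * n := by exact_mod_cast h3
  rw [div_lt_iff₀ (by exact_mod_cast h2)] at hn
  have h4 : (((Finset.range n).filter fun j => Covered S a 0 j).card : ℝ) ≤
      mass S a 0 (winIdx n + 1) := by exact_mod_cast card_covered_le S a 0 n
  have h5 : ∀ j ∈ (Finset.range n).filter (fun j => Covered S a 0 j),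
      logLen j ≤ Real.log (winLen (winIdx n + 1)) := fun j hj => by
    have e1 : j ≤ n := (Finset.mem_range.1 (Finset.mem_filter.1 hj).1).le
    have e2 := two_le_winLen (winIdx j)
    refine Real.log_le_log (by positivity) ?_
    exact_mod_cast winLen_mono ((winIdx_mono e1).trans (Nat.le_succ _))
  have h6 := Finset.sum_le_card_nsmul _ _ _ h5
  rw [nsmul_eq_mul] at h6
  have h7 : 0 ≤ Real.log (winLen (winIdx n + 1)) := by positivity
  nlinarith

lemma insChoices_pos (S : Set ℕ) (a : ℕ → ℕ) (n : ℕ) : 1 ≤ insChoices S a n := by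
  have := two_le_winLen (winIdx n)
  unfold insChoices
  split_ifs
  · exact le_rfl
  · exact Nat.one_le_pow _ _ (by omega)

lemma log_qprod_winBase (n : ℕ) : Real.log (qprod winBase n) =
    n * Real.log 4 + 2 * ∑ j ∈ Finset.range n, logLen j := by
  rw [qprod, Real.log_prod (fun i _ => (winBase_pos i).ne'), Finset.mul_sum]
  have : ∀ i ∈ Finset.range n, Real.log (winBase i) = Real.log 4 + 2 * logLen i := by
    intro i _
    have h1 := two_le_winLen (winIdx i)
    simp only [winBase, logLen]
    push_cast
    rw [Real.log_mul (by norm_num) (by positivity), Real.log_pow]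
    norm_num
  rw [Finset.sum_congr rfl this, Finset.sum_add_distrib]
  simp

lemma log_qprod_insChoices (S : Set ℕ) (a : ℕ → ℕ) (n : ℕ) :
    Real.log (qprod (insChoices S a) n) = 2 * ∑ j ∈ Finset.range n, logLen j -
      2 * ∑ j ∈ (Finset.range n).filter (fun j => Covered S a 0 j), logLen j := by
  rw [qprod, Real.log_prod (fun i _ => by
    have := insChoices_pos S a i
    positivity), Finset.sum_filter, Finset.mul_sum, Finset.mul_sum, ← Finset.sum_sub_distrib]
  refine Finset.sum_congr rfl fun i _ => ?_
  simp only [insChoices, logLen]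
  split_ifs <;> simp

lemma exists_qprod_rpow_le {S : Set ℕ} {a : ℕ → ℕ} (ha : IsGate S a) {s : ℝ} (hs0 : 0 < s)
    (hs1 : s < 1) : ∃ C : ℝ, ∀ n, qprod winBase (n + 1) ^ s ≤ C * qprod (insChoices S a) n := by
  have hqpos : ∀ n, 0 < qprod winBase n := qprod_pos fun n => by
    have := isBasic_winBase n
    omega
  have hmpos := qprod_pos (insChoices_pos S a)
  have hA : 0 < 5 / (1 - s) := div_pos (by norm_num) (by linarith)
  have hev : ∀ᶠ n in atTop, qprod winBase (n + 1) ^ s ≤ qprod (insChoices S a) n := by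
    filter_upwards [eventually_le_sum_logLen hA, eventually_sum_covered_le ha,
      eventually_ge_atTop 1] with n h1 h2 hn
    rw [← Real.log_le_log_iff (Real.rpow_pos_of_pos (hqpos _) s) (hmpos n),
      Real.log_rpow (hqpos _), log_qprod_winBase, log_qprod_insChoices, Finset.sum_range_succ]
    have h3 := logLen_le n
    have h4 : Real.log 4 ≤ 2 := by
      have : Real.log 4 = 2 * Real.log 2 := by
        rw [show (4 : ℝ) = 2 ^ 2 by norm_num, Real.log_pow]
        norm_num
      have := Real.log_two_lt_d9
      linarith
    have hn' : (1 : ℝ) ≤ n := by exact_mod_cast hn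
    rw [div_mul_eq_mul_div, div_le_iff₀ (by linarith)] at h1
    have h5 : s * (((n + 1 : ℕ) : ℝ) * Real.log 4 + 2 * logLen n) ≤ 8 * n := by
      have e1 : ((n + 1 : ℕ) : ℝ) * Real.log 4 ≤ (n + 1) * 2 := by
        push_cast
        gcongr
      have e2 : 0 ≤ Real.log 4 := Real.log_nonneg (by norm_num)
      have e3 := logLen_nonneg n
      have e4 : 0 ≤ ((n + 1 : ℕ) : ℝ) * Real.log 4 + 2 * logLen n := by positivity
      calc _ ≤ 1 * (((n + 1 : ℕ) : ℝ) * Real.log 4 + 2 * logLen n) := by gcongr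
        _ ≤ _ := by linarith
    linarith
  obtain ⟨N, hN⟩ := eventually_atTop.1 hev
  have hnn : ∀ n, 0 ≤ qprod winBase (n + 1) ^ s := fun n => (Real.rpow_pos_of_pos (hqpos _) s).le
  have hone : ∀ n, 1 ≤ qprod (insChoices S a) n := fun n => by
    have : (0 : ℝ) < ((∏ i ∈ Finset.range n, insChoices S a i : ℕ) : ℝ) := by
      simpa [qprod] using hmpos n
    have h' : 1 ≤ ∏ i ∈ Finset.range n, insChoices S a i := by exact_mod_cast this
    unfold qprod
    exact_mod_cast h'
  refine ⟨1 + ∑ n ∈ Finset.range N, qprod winBase (n + 1) ^ s, fun n => ?_⟩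
  have hsum : 0 ≤ ∑ n ∈ Finset.range N, qprod winBase (n + 1) ^ s :=
    Finset.sum_nonneg fun n _ => hnn n
  have h1 := hone n
  rcases lt_or_ge n N with h | h
  · have h2 := Finset.single_le_sum (f := fun n => qprod winBase (n + 1) ^ s)
      (fun i _ => hnn i) (Finset.mem_range.2 h)
    nlinarith
  · have h2 := hN n h
    nlinarith

lemma one_le_dimH_insSet {S : Set ℕ} {a : ℕ → ℕ} (ha : IsGate S a) : 1 ≤ dimH (insSet S a) := by
  refine one_le_dimH_digit_set isBasic_winBase (insChoices_pos S a) (fun n => ?_) (fun n => ?_)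
    fun s hs0 hs1 => exists_qprod_rpow_le ha hs0 hs1
  · have h1 := two_le_winLen (winIdx n)
    by_cases hc : Covered S a 0 n
    · have h2 := insDigit_lt ha hc
      rw [insChoices, if_pos hc, winBase]
      nlinarith
    · rw [insChoices, if_neg hc, insDigit, dif_neg hc, winBase]
      nlinarith
  · have h1 := two_le_winLen (winIdx n)
    unfold insChoices winBase
    split_ifs <;> nlinarith

/-- For every set `S` of positive integers almost closed under addition there is a fully
divergent, infinite in limit basic sequence `Q` such that
`dim_H(⋂_{k∈S} N_k(Q) \ ⋃_{k∉S} N_k(Q)) = 1`. -/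
theorem stmt1 (S : Set ℕ) (hSpos : 0 ∉ S) (hS : AlmostClosed S) :
    ∃ Q : ℕ → ℕ, IsBasic Q ∧ FullyDivergent Q ∧ InfiniteInLimit Q ∧
      dimH ((⋂ k ∈ S, {x : ℝ | QNormalOfOrder Q k x}) \
        ⋃ k ∈ {k : ℕ | 1 ≤ k ∧ k ∉ S}, {x : ℝ | QNormalOfOrder Q k x}) = 1 := by
  obtain ⟨a, ha'⟩ := exists_gate
  have hpos : ∀ k ∈ S, 1 ≤ k := fun k hk =>
    Nat.one_le_iff_ne_zero.2 fun h => hSpos (h ▸ hk)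
  have ha : IsGate S a := fun t ht => ⟨hpos _ ht, ha' t (hpos _ ht)⟩
  refine ⟨winBase, isBasic_winBase, fun k _ => tendsto_Qsum_winBase k, infiniteInLimit_winBase,
    le_antisymm ((dimH_mono (Set.subset_univ _)).trans Real.dimH_univ.le)
      ((one_le_dimH_insSet ha).trans (dimH_mono fun x hx => ⟨?_, fun hmem => ?_⟩))⟩
  · exact Set.mem_iInter₂.2 fun k hk B => tendsto_blockCount_of_mem ha hx (hpos k hk) hk B
  · obtain ⟨k, ⟨hk, hkS⟩, hnormal⟩ := Set.mem_iUnion₂.1 hmem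
    have h0 := tendsto_blockCount_of_notMem ha hx hk hkS fun _ => 0
    exact zero_ne_one (tendsto_nhds_unique h0 (hnormal fun _ => 0))
end
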